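/- arXiv:1606.08937 — 2 statements merged into one kernel-verified Lean document; each statement's English description precedes it below -/
import Mathlib

section
/- Let p > 0 and 0 < γ < 1. Define G : (0,∞) → ℝ by G(q) = J_1(z₋(q)) K_0(z₊(q)) / z₊(q) + J_0(z₋(q)) K_1(z₊(q)) / z₋(q), where z_±(q) = √(2p)·(√(q²+γ²) ± q)^{1/2}. Then S_{1/2, p}(γ) = −4γ ∑_{k≥1} G'''(k), where G''' denotes the third derivative of G. -/
open Real MeasureTheory

/-- Bessel function of the first kind of integer order, via Bessel's integral. -/
noncomputable def besselJ (m : ℤ) (x : ℝ) : ℝ :=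
  (1 / Real.pi) * ∫ θ in (0:ℝ)..Real.pi, Real.cos ((m : ℝ) * θ - x * Real.sin θ)

/-- Modified Bessel function of the second kind (real argument). -/
noncomputable def besselK (ν x : ℝ) : ℝ :=
  ∫ t in Set.Ioi (0:ℝ), Real.exp (-x * Real.cosh t) * Real.cosh (ν * t)

/-- Modified Bessel function of the second kind (complex argument). -/
noncomputable def besselKC (ν : ℝ) (z : ℂ) : ℂ :=
  ∫ t in Set.Ioi (0:ℝ), Complex.exp (-z * (Real.cosh t : ℂ)) * (Real.cosh (ν * t) : ℂ)

/-- The p-extended Riemann zeta function. -/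
noncomputable def zetaP (p α : ℝ) : ℝ :=
  (1 / Real.Gamma α) *
    ∫ t in Set.Ioi (0:ℝ), t ^ (α - 1) * Real.exp (-p / t) / (Real.exp t - 1)

/-- The p-extended Mathieu series. -/
noncomputable def mathieuS (μ p r : ℝ) : ℝ :=
  2 * ∑' n : ℕ, (-1 : ℝ) ^ n *
      (Real.Gamma (μ + n + 1) / (n.factorial * Real.Gamma (μ + 1))) *
      zetaP p (2 * μ + 2 * n + 1) * r ^ (2 * n)

open Set Filter Topology

lemma zpow_mul_exp_neg_inv_le (k : ℕ) {p t : ℝ} (hp : 0 < p) (ht : 0 < t) :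
    t ^ (-(k : ℤ)) * exp (-(p / t)) ≤ k.factorial / p ^ k := by
  have h := pow_div_factorial_le_exp (p / t) (by positivity) k
  rw [zpow_neg, zpow_natCast, exp_neg, div_pow] at *
  rw [div_div, div_le_iff₀ (by positivity)] at h
  rw [← mul_inv, le_div_iff₀ (by positivity), inv_mul_le_iff₀ (by positivity)]
  linarith

lemma integrableOn_pow_mul_exp_neg (n : ℕ) {q : ℝ} (hq : 0 < q) :
    IntegrableOn (fun t : ℝ => t ^ n * exp (-(q * t))) (Ioi 0) := by
  have h := integrableOn_rpow_mul_exp_neg_mul_rpow (p := 1) (s := n) (b := q)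
    (by have : (0 : ℝ) ≤ n := n.cast_nonneg
        linarith) one_pos hq
  simpa using h

lemma integrableOn_zpow_mul_exp (m : ℤ) {p q : ℝ} (hp : 0 < p) (hq : 0 < q) :
    IntegrableOn (fun t : ℝ => t ^ m * exp (-(p / t) - q * t)) (Ioi 0) := by
  have hmeas : AEStronglyMeasurable (fun t : ℝ => t ^ m * exp (-(p / t) - q * t))
      (volume.restrict (Ioi 0)) := by
    refine ContinuousOn.aestronglyMeasurable (fun t ht => ?_) measurableSet_Ioi
    have : t ≠ 0 := ne_of_gt ht
    exact ContinuousAt.continuousWithinAt (by fun_prop (disch := simp [this]))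
  obtain ⟨n, rfl | rfl⟩ := m.eq_nat_or_neg
  · refine (integrableOn_pow_mul_exp_neg n hq).mono' hmeas ?_
    filter_upwards [ae_restrict_mem measurableSet_Ioi] with t ht
    have ht : 0 < t := ht
    rw [norm_of_nonneg (by positivity), zpow_natCast]
    gcongr
    have : 0 ≤ p / t := by positivity
    linarith
  · refine ((integrableOn_pow_mul_exp_neg 0 hq).const_mul (n.factorial / p ^ n)).mono' hmeas ?_
    filter_upwards [ae_restrict_mem measurableSet_Ioi] with t ht
    have ht : 0 < t := ht
    rw [norm_of_nonneg (by positivity), sub_eq_add_neg, exp_add, ← mul_assoc, pow_zero, one_mul]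
    gcongr
    exact zpow_mul_exp_neg_inv_le n hp ht

/-- Differentiation of a weighted Laplace transform with weight `t ^ m * exp (-p / t) * f t`. -/
lemma hasDerivAt_laplace (m : ℤ) {p q : ℝ} (hp : 0 < p) (hq : 0 < q) {f : ℝ → ℝ}
    (hf : Continuous f) (hb : ∀ t, |f t| ≤ 1) :
    HasDerivAt (fun q => ∫ t in Ioi (0 : ℝ), t ^ m * exp (-(p / t) - q * t) * f t)
      (-∫ t in Ioi (0 : ℝ), t ^ (m + 1) * exp (-(p / t) - q * t) * f t) q := by
  have hmeas : ∀ (m : ℤ) (q : ℝ), AEStronglyMeasurable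
      (fun t : ℝ => t ^ m * exp (-(p / t) - q * t) * f t) (volume.restrict (Ioi 0)) := by
    intro m q
    refine ContinuousOn.aestronglyMeasurable (fun t ht => ?_) measurableSet_Ioi
    have : t ≠ 0 := ne_of_gt ht
    exact ContinuousAt.continuousWithinAt (by fun_prop (disch := simp [this]))
  have h := hasDerivAt_integral_of_dominated_loc_of_deriv_le (μ := volume.restrict (Ioi (0 : ℝ)))
    (F := fun q t => t ^ m * exp (-(p / t) - q * t) * f t) (x₀ := q) (s := Ioi (q / 2))
    (F' := fun q t => -(t ^ (m + 1) * exp (-(p / t) - q * t) * f t))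
    (bound := fun t => t ^ (m + 1) * exp (-(p / t) - q / 2 * t))
    (Ioi_mem_nhds (by linarith)) (Eventually.of_forall (hmeas m)) ?_ (hmeas _ _).neg ?_
    (integrableOn_zpow_mul_exp _ hp (by linarith)) ?_
  · simpa [integral_neg] using h.2
  · exact (integrableOn_zpow_mul_exp m hp hq).mul_bdd (c := 1) hf.aestronglyMeasurable
      (Eventually.of_forall hb)
  · filter_upwards [ae_restrict_mem measurableSet_Ioi] with t ht x hx
    have ht : 0 < t := ht
    have hx : q / 2 < x := hx
    rw [norm_neg, norm_mul, norm_of_nonneg (by positivity), norm_eq_abs,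
      ← mul_one (t ^ (m + 1) * exp (-(p / t) - q / 2 * t))]
    gcongr
    exact hb t
  · filter_upwards [ae_restrict_mem measurableSet_Ioi] with t ht x hx
    have ht : 0 < t := ht
    have := ((((hasDerivAt_id' x).mul_const t).const_sub (-(p / t))).exp.const_mul
      (t ^ m)).mul_const (f t)
    refine this.congr_deriv ?_
    rw [zpow_add_one₀ ht.ne']
    ring

lemma iteratedDeriv_laplace (m : ℤ) {p q : ℝ} (hp : 0 < p) (hq : 0 < q) {f : ℝ → ℝ}
    (hf : Continuous f) (hb : ∀ t, |f t| ≤ 1) (n : ℕ) :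
    iteratedDeriv n (fun q => ∫ t in Ioi (0 : ℝ), t ^ m * exp (-(p / t) - q * t) * f t) q =
      (-1) ^ n * ∫ t in Ioi (0 : ℝ), t ^ (m + n) * exp (-(p / t) - q * t) * f t := by
  induction n generalizing q with
  | zero => simp
  | succ n ih =>
    rw [iteratedDeriv_succ]
    have : iteratedDeriv n (fun q => ∫ t in Ioi (0 : ℝ), t ^ m * exp (-(p / t) - q * t) * f t)
        =ᶠ[𝓝 q] fun q => (-1) ^ n *
          ∫ t in Ioi (0 : ℝ), t ^ (m + n) * exp (-(p / t) - q * t) * f t := by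
      filter_upwards [Ioi_mem_nhds hq] with x hx using ih hx
    rw [this.deriv_eq, ((hasDerivAt_laplace (m + n) hp hq hf hb).const_mul _).deriv, pow_succ,
      Nat.cast_succ, add_assoc]
    ring

lemma norm_cexp_neg_div_sub_mul (A B : ℂ) (t : ℝ) :
    ‖Complex.exp (-(A / t) - B * t)‖ = exp (-(A.re / t) - B.re * t) := by
  rw [Complex.norm_exp]
  simp [Complex.div_ofReal_re]

/-- `c * F(c * t)` where `F(z) = z⁻² * exp (-p / z - w * z)`. -/
noncomputable def rotKernel (p w c : ℂ) (t : ℝ) : ℂ :=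
  c⁻¹ * (t : ℂ) ^ (-2 : ℤ) * Complex.exp (-(p * c⁻¹ / t) - w * c * t)

/-- The derivative of `rotKernel p w c t` with respect to `c`. -/
noncomputable def rotKernelDeriv (p w c : ℂ) (t : ℝ) : ℂ :=
  (-(c⁻¹ ^ 2 * (t : ℂ) ^ (-2 : ℤ)) + p * c⁻¹ ^ 3 * (t : ℂ) ^ (-3 : ℤ) -
    w * c⁻¹ * (t : ℂ) ^ (-1 : ℤ)) * Complex.exp (-(p * c⁻¹ / t) - w * c * t)

lemma hasDerivAt_rotKernel (p w : ℂ) {c : ℂ} (hc : c ≠ 0) {t : ℝ} (ht : 0 < t) :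
    HasDerivAt (fun c => rotKernel p w c t) (rotKernelDeriv p w c t) c := by
  have ht' : (t : ℂ) ≠ 0 := by exact_mod_cast ht.ne'
  have h1 := hasDerivAt_inv hc
  have h2 : HasDerivAt (fun c => -(p * c⁻¹ / t) - w * c * t)
      (-(p * -(c ^ 2)⁻¹ / t) - w * 1 * t) c :=
    ((h1.const_mul p).div_const (t : ℂ)).neg.sub
      (((hasDerivAt_id' c).const_mul w).mul_const (t : ℂ))
  have h3 := (h1.mul_const ((t : ℂ) ^ (-2 : ℤ))).mul h2.cexp
  refine h3.congr_deriv ?_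
  rw [rotKernelDeriv]
  generalize Complex.exp _ = E
  simp only [zpow_neg]
  norm_cast
  push_cast
  field_simp
  ring

lemma hasDerivAt_rotKernel_primitive (p w : ℂ) {c : ℂ} (hc : c ≠ 0) {t : ℝ} (ht : 0 < t) :
    HasDerivAt (fun t : ℝ => c⁻¹ ^ 2 * (t : ℂ) ^ (-1 : ℤ) *
      Complex.exp (-(p * c⁻¹ / t) - w * c * t)) (rotKernelDeriv p w c t) t := by
  have ht' : (t : ℂ) ≠ 0 := by exact_mod_cast ht.ne'
  have h1 := hasDerivAt_inv ht'
  have h2 : HasDerivAt (fun t => -(p * c⁻¹ * t⁻¹) - w * c * t)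
      (-(p * c⁻¹ * -((t : ℂ) ^ 2)⁻¹) - w * c * 1) (t : ℂ) :=
    (h1.const_mul (p * c⁻¹)).neg.sub ((hasDerivAt_id' (t : ℂ)).const_mul (w * c))
  have h3 := ((h1.const_mul (c⁻¹ ^ 2)).mul h2.cexp).comp_ofReal
  have h4 := h3.congr_deriv (f' := _) (g' := rotKernelDeriv p w c t) (by
    rw [rotKernelDeriv, div_eq_mul_inv]
    generalize Complex.exp _ = E
    simp only [zpow_neg]
    norm_cast
    push_cast
    field_simp
    ring)
  simpa [div_eq_mul_inv, Pi.mul_def] using h4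

lemma continuousOn_rotKernel (p w c : ℂ) : ContinuousOn (rotKernel p w c) (Ioi 0) := by
  intro t ht
  have : (t : ℂ) ≠ 0 := by exact_mod_cast ne_of_gt ht
  unfold rotKernel
  exact ContinuousAt.continuousWithinAt (by fun_prop (disch := simp_all))

lemma continuousOn_rotKernelDeriv (p w c : ℂ) : ContinuousOn (rotKernelDeriv p w c) (Ioi 0) := by
  intro t ht
  have : (t : ℂ) ≠ 0 := by exact_mod_cast ne_of_gt ht
  unfold rotKernelDeriv
  exact ContinuousAt.continuousWithinAt (by fun_prop (disch := simp_all))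

lemma norm_rotKernelDeriv_le {p w c : ℂ} {M δ ε t : ℝ} (hM : 0 ≤ M)
    (hc : ‖c⁻¹‖ ≤ M) (h1 : δ ≤ (p * c⁻¹).re) (h2 : ε ≤ (w * c).re) (ht : 0 < t) :
    ‖rotKernelDeriv p w c t‖ ≤ M ^ 2 * (t ^ (-2 : ℤ) * exp (-(δ / t) - ε * t)) +
      ‖p‖ * M ^ 3 * (t ^ (-3 : ℤ) * exp (-(δ / t) - ε * t)) +
      ‖w‖ * M * (t ^ (-1 : ℤ) * exp (-(δ / t) - ε * t)) := by
  have hn : ∀ m : ℤ, ‖(t : ℂ) ^ m‖ = t ^ m := fun m => by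
    rw [norm_zpow, Complex.norm_real, norm_of_nonneg ht.le]
  have he : ‖Complex.exp (-(p * c⁻¹ / t) - w * c * t)‖ ≤ exp (-(δ / t) - ε * t) := by
    rw [norm_cexp_neg_div_sub_mul]
    gcongr
  have hp : ‖-(c⁻¹ ^ 2 * (t : ℂ) ^ (-2 : ℤ)) + p * c⁻¹ ^ 3 * (t : ℂ) ^ (-3 : ℤ) -
      w * c⁻¹ * (t : ℂ) ^ (-1 : ℤ)‖ ≤ M ^ 2 * t ^ (-2 : ℤ) + ‖p‖ * M ^ 3 * t ^ (-3 : ℤ) +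
        ‖w‖ * M * t ^ (-1 : ℤ) := by
    refine (norm_sub_le _ _).trans (add_le_add ((norm_add_le _ _).trans (add_le_add ?_ ?_)) ?_)
    · rw [norm_neg, norm_mul, norm_pow, hn]
      gcongr
    · rw [norm_mul, norm_mul, norm_pow, hn]
      gcongr
    · rw [norm_mul, norm_mul, hn]
      gcongr
  calc _ ≤ _ := norm_mul_le _ _
    _ ≤ (M ^ 2 * t ^ (-2 : ℤ) + ‖p‖ * M ^ 3 * t ^ (-3 : ℤ) + ‖w‖ * M * t ^ (-1 : ℤ)) *
          exp (-(δ / t) - ε * t) := by gcongr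
    _ = _ := by ring

lemma norm_rotKernel (p w c : ℂ) {t : ℝ} (ht : 0 < t) : ‖rotKernel p w c t‖ =
    ‖c⁻¹‖ * (t ^ (-2 : ℤ) * exp (-((p * c⁻¹).re / t) - (w * c).re * t)) := by
  rw [rotKernel, norm_mul, norm_mul, norm_zpow, Complex.norm_real, norm_of_nonneg ht.le,
    norm_cexp_neg_div_sub_mul, mul_assoc]

lemma integrableOn_rotKernel {p w c : ℂ} (h1 : 0 < (p * c⁻¹).re) (h2 : 0 < (w * c).re) :
    IntegrableOn (rotKernel p w c) (Ioi 0) := by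
  refine ((integrableOn_zpow_mul_exp (-2) h1 h2).const_mul ‖c⁻¹‖).mono'
    ((continuousOn_rotKernel p w c).aestronglyMeasurable measurableSet_Ioi) ?_
  filter_upwards [ae_restrict_mem measurableSet_Ioi] with t ht
  exact (norm_rotKernel p w c ht).le

lemma integrableOn_rotKernelDeriv_bound (a b c : ℝ) {δ ε : ℝ} (hδ : 0 < δ) (hε : 0 < ε) :
    IntegrableOn (fun t : ℝ => a * (t ^ (-2 : ℤ) * exp (-(δ / t) - ε * t)) +
      b * (t ^ (-3 : ℤ) * exp (-(δ / t) - ε * t)) +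
      c * (t ^ (-1 : ℤ) * exp (-(δ / t) - ε * t))) (Ioi 0) :=
  (((integrableOn_zpow_mul_exp _ hδ hε).const_mul _).add
    ((integrableOn_zpow_mul_exp _ hδ hε).const_mul _)).add
    ((integrableOn_zpow_mul_exp _ hδ hε).const_mul _)

lemma integral_rotKernelDeriv {p w c : ℂ} (hc : c ≠ 0) (h1 : 0 < (p * c⁻¹).re)
    (h2 : 0 < (w * c).re) : ∫ t in Ioi (0 : ℝ), rotKernelDeriv p w c t = 0 := by
  have hnorm : ∀ t : ℝ, 0 < t → ‖c⁻¹ ^ 2 * (t : ℂ) ^ (-1 : ℤ) *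
      Complex.exp (-(p * c⁻¹ / t) - w * c * t)‖ =
      ‖c⁻¹‖ ^ 2 * (t ^ (-1 : ℤ) * exp (-((p * c⁻¹).re / t) - (w * c).re * t)) := by
    intro t ht
    rw [norm_mul, norm_mul, norm_pow, norm_zpow, Complex.norm_real, norm_of_nonneg ht.le,
      norm_cexp_neg_div_sub_mul, mul_assoc]
  have h := integral_Ioi_of_hasDerivAt_of_tendsto (a := 0) (m := 0)
    (f := fun t : ℝ => c⁻¹ ^ 2 * (t : ℂ) ^ (-1 : ℤ) *
      Complex.exp (-(p * c⁻¹ / t) - w * c * t)) ?_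
    (fun t ht => hasDerivAt_rotKernel_primitive p w hc ht) ?_ ?_
  · simpa using h
  · rw [← continuousWithinAt_Ioi_iff_Ici, ContinuousWithinAt]
    simp only [Complex.ofReal_zero, zpow_neg_one, inv_zero, mul_zero, zero_mul]
    have hlim : Tendsto (fun t : ℝ => ‖c⁻¹‖ ^ 2 * ((Nat.factorial 2 / (p * c⁻¹).re ^ 2) * t))
        (𝓝[>] 0) (𝓝 0) := by
      have : Continuous (fun t : ℝ => ‖c⁻¹‖ ^ 2 * ((Nat.factorial 2 / (p * c⁻¹).re ^ 2) * t)) := by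
        fun_prop
      simpa using (this.tendsto 0).mono_left nhdsWithin_le_nhds
    refine squeeze_zero_norm' ?_ hlim
    filter_upwards [self_mem_nhdsWithin] with t ht
    have ht : 0 < t := ht
    have := hnorm t ht
    simp only [zpow_neg_one] at this
    rw [this]
    refine mul_le_mul_of_nonneg_left ?_ (by positivity)
    have h3 := zpow_mul_exp_neg_inv_le 2 h1 ht
    calc t⁻¹ * exp (-((p * c⁻¹).re / t) - (w * c).re * t)
        ≤ t⁻¹ * exp (-((p * c⁻¹).re / t)) := by
          gcongr
          have : 0 < (w * c).re * t := by positivity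
          linarith
      _ = (t ^ (-((2 : ℕ) : ℤ)) * exp (-((p * c⁻¹).re / t))) * t := by
          rw [zpow_neg, zpow_natCast]
          field_simp
      _ ≤ _ := by gcongr
  · refine (integrableOn_rotKernelDeriv_bound (‖c⁻¹‖ ^ 2) (‖p‖ * ‖c⁻¹‖ ^ 3) (‖w‖ * ‖c⁻¹‖)
      h1 h2).mono'
      ((continuousOn_rotKernelDeriv p w c).aestronglyMeasurable measurableSet_Ioi) ?_
    filter_upwards [ae_restrict_mem measurableSet_Ioi] with t ht
    exact norm_rotKernelDeriv_le (norm_nonneg _) le_rfl le_rfl le_rfl ht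
  · have hlim : Tendsto (fun t : ℝ => ‖c⁻¹‖ ^ 2 * t⁻¹) atTop (𝓝 0) := by
      simpa only [mul_zero] using (tendsto_inv_atTop_zero (𝕜 := ℝ)).const_mul (‖c⁻¹‖ ^ 2)
    refine squeeze_zero_norm' ?_ hlim
    filter_upwards [eventually_gt_atTop 0] with t ht
    rw [hnorm t ht, zpow_neg_one]
    gcongr
    refine mul_le_of_le_one_right (by positivity) (exp_le_one_iff.2 ?_)
    have : 0 < (w * c).re * t := by positivity
    have : 0 < (p * c⁻¹).re / t := by positivity
    linarith

lemma hasDerivAt_integral_rotKernel {p w c : ℂ} (hc : c ≠ 0) (h1 : 0 < (p * c⁻¹).re)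
    (h2 : 0 < (w * c).re) :
    HasDerivAt (fun c => ∫ t in Ioi (0 : ℝ), rotKernel p w c t) 0 c := by
  set δ := (p * c⁻¹).re / 2 with hδ
  set ε := (w * c).re / 2 with hε
  have hs : {x : ℂ | x ≠ 0 ∧ ‖x⁻¹‖ < ‖c⁻¹‖ + 1 ∧ δ < (p * x⁻¹).re ∧ ε < (w * x).re} ∈ 𝓝 c := by
    have c1 : ContinuousAt (fun x : ℂ => ‖x⁻¹‖) c := by fun_prop (disch := assumption)
    have c2 : ContinuousAt (fun x : ℂ => (p * x⁻¹).re) c :=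
      Complex.continuous_re.continuousAt.comp (by fun_prop (disch := assumption))
    have c3 : ContinuousAt (fun x : ℂ => (w * x).re) c :=
      Complex.continuous_re.continuousAt.comp (by fun_prop)
    filter_upwards [isOpen_ne.mem_nhds hc, c1.eventually_lt_const (lt_add_one _),
      c2.eventually_const_lt (half_lt_self h1), c3.eventually_const_lt (half_lt_self h2)]
      with x a b c d using ⟨a, b, c, d⟩
  have h := hasDerivAt_integral_of_dominated_loc_of_deriv_le
    (μ := volume.restrict (Ioi (0 : ℝ))) (F := rotKernel p w) (F' := rotKernelDeriv p w) hs
    (Eventually.of_forall fun x =>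
      (continuousOn_rotKernel p w x).aestronglyMeasurable measurableSet_Ioi)
    (integrableOn_rotKernel h1 h2)
    ((continuousOn_rotKernelDeriv p w c).aestronglyMeasurable measurableSet_Ioi)
    (by
      filter_upwards [ae_restrict_mem measurableSet_Ioi] with t ht x hx
      exact norm_rotKernelDeriv_le (by positivity) hx.2.1.le hx.2.2.1.le hx.2.2.2.le ht)
    (integrableOn_rotKernelDeriv_bound _ _ _ (by positivity) (by positivity))
    (by
      filter_upwards [ae_restrict_mem measurableSet_Ioi] with t ht x hx
      exact hasDerivAt_rotKernel p w hx.1 ht)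
  rw [← integral_rotKernelDeriv hc h1 h2]
  exact h.2

/-- Rotation of the ray of integration. -/
lemma integral_rotKernel_eq {p : ℝ} (hp : 0 < p) {w c : ℂ} (hw : 0 < w.re) (hc : 0 < c.re)
    (hwc : 0 < (w * c).re) :
    ∫ t in Ioi (0 : ℝ), rotKernel p w c t = ∫ t in Ioi (0 : ℝ), rotKernel p w 1 t := by
  let U : Set ℂ := {c | 0 < c.re} ∩ {c | 0 < (w * c).re}
  have hne : ∀ x ∈ U, x ≠ 0 := by
    rintro x ⟨hx, -⟩ rfl
    simp at hx
  have hU : IsOpen U := (isOpen_lt continuous_const Complex.continuous_re).inter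
    (isOpen_lt continuous_const (Complex.continuous_re.comp (by fun_prop)))
  have hconv : Convex ℝ U := by
    refine (convex_halfSpace_re_gt 0).inter ?_
    exact (convex_halfSpace_re_gt 0).is_linear_preimage (f := fun c => w * c)
      ⟨fun x y => mul_add _ _ _, fun r x => by simp [Complex.real_smul]; ring⟩
  have hd : ∀ x ∈ U, HasDerivAt (fun c => ∫ t in Ioi (0 : ℝ), rotKernel p w c t) 0 x := by
    intro x hx
    refine hasDerivAt_integral_rotKernel (hne x hx) ?_ hx.2
    rw [Complex.re_ofReal_mul, Complex.inv_re]
    have := Complex.normSq_pos.2 (hne x hx)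
    have := hx.1
    rw [mem_ofPred_eq] at this
    positivity
  exact hU.is_const_of_deriv_eq_zero hconv.isPreconnected
    (fun x hx => (hd x hx).differentiableAt.differentiableWithinAt)
    (fun x hx => (hd x hx).deriv) ⟨hc, hwc⟩ ⟨by simp, by simpa using hw⟩

lemma integral_circleMap_eq_of_differentiable {f : ℂ → ℂ}
    (hf : ∀ z, z ≠ 0 → DifferentiableAt ℂ f z) {r R : ℝ} (hr : 0 < r) (hR : 0 < R) :
    ∫ θ in (0 : ℝ)..2 * π, f (circleMap 0 R θ) = ∫ θ in (0 : ℝ)..2 * π, f (circleMap 0 r θ) := by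
  wlog h : r ≤ R generalizing r R
  · exact (this hR hr (le_of_not_ge h)).symm
  have key : ∀ ρ : ℝ, 0 < ρ → (∮ z in C(0, ρ), (z - 0)⁻¹ • f z) =
      Complex.I * ∫ θ in (0 : ℝ)..2 * π, f (circleMap 0 ρ θ) := by
    intro ρ hρ
    rw [circleIntegral, ← intervalIntegral.integral_const_mul]
    refine intervalIntegral.integral_congr fun θ _ => ?_
    have : circleMap 0 ρ θ ≠ 0 := by simp [circleMap, hρ.ne']
    simp only [deriv_circleMap, sub_zero, smul_eq_mul]
    field_simp
  have := Complex.circleIntegral_sub_center_inv_smul_eq_of_differentiable_on_annulus_off_countable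
    (c := 0) hr h (f := f) countable_empty
    (fun z hz => (hf z (by
      rintro rfl
      simp [hr] at hz)).continuousAt.continuousWithinAt)
    (fun z hz => hf z (by
      rintro rfl
      simp [hr.le] at hz))
  rw [key _ hr, key _ hR] at this
  exact mul_left_cancel₀ Complex.I_ne_zero this

lemma besselJ_eq_integral_cexp (m : ℤ) (x : ℝ) :
    ∫ θ in (0 : ℝ)..2 * π, Complex.exp (-(Complex.I * (m * θ - x * sin θ))) =
      2 * π * besselJ m x := by
  set g : ℝ → ℂ := fun θ => Complex.exp (-(Complex.I * (m * θ - x * sin θ))) with hg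
  have hper : Function.Periodic g (2 * π) := by
    intro θ
    simp only [hg, sin_add_two_pi]
    rw [← Complex.exp_periodic.int_mul m]
    congr 1
    push_cast
    ring
  have hcont : Continuous g := by fun_prop
  have h1 : ∫ θ in (0 : ℝ)..2 * π, g θ = ∫ θ in (-π)..π, g θ := by
    have := hper.intervalIntegral_add_eq 0 (-π)
    rw [zero_add] at this
    rw [this]
    congr 1
    ring
  have h2 : ∫ θ in (-π)..0, g θ = ∫ θ in (0 : ℝ)..π, g (-θ) := by
    rw [intervalIntegral.integral_comp_neg]
    simp
  rw [h1, ← intervalIntegral.integral_add_adjacent_intervals (b := 0)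
    (hcont.intervalIntegrable _ _) (hcont.intervalIntegrable _ _), h2,
    ← intervalIntegral.integral_add ((hcont.comp' continuous_neg).intervalIntegrable _ _)
    (hcont.intervalIntegrable _ _)]
  have h3 : ∀ θ : ℝ, g (-θ) + g θ = ((2 * cos (m * θ - x * sin θ) : ℝ) : ℂ) := by
    intro θ
    simp only [hg, sin_neg]
    push_cast
    rw [Complex.two_cos]
    congr 2 <;> ring
  simp only [h3]
  rw [intervalIntegral.integral_ofReal, intervalIntegral.integral_const_mul, besselJ]
  push_cast
  have : (π : ℂ) ≠ 0 := by exact_mod_cast pi_ne_zero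
  field_simp

lemma continuous_besselJ (m : ℤ) : Continuous (besselJ m) := by
  unfold besselJ
  refine continuous_const.mul ?_
  exact intervalIntegral.continuous_parametric_intervalIntegral_of_continuous'
    (by fun_prop) _ _

lemma abs_besselJ_le_one (m : ℤ) (x : ℝ) : |besselJ m x| ≤ 1 := by
  have h := intervalIntegral.norm_integral_le_of_norm_le_const (a := 0) (b := π) (C := 1)
    (f := fun θ => cos (m * θ - x * sin θ)) (fun θ _ => abs_cos_le_one _)
  rw [besselJ, abs_mul, abs_of_nonneg (by positivity)]
  rw [sub_zero, abs_of_pos pi_pos, one_mul, norm_eq_abs] at h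
  rw [one_div, inv_mul_le_iff₀ pi_pos]
  simpa using h

lemma integral_sin_pow_even_eq_factorial (n : ℕ) :
    ∫ θ in (0 : ℝ)..π, sin θ ^ (2 * n) =
      π * ((2 * n).factorial / (2 ^ (2 * n) * (n.factorial : ℝ) ^ 2)) := by
  rw [integral_sin_pow_even]
  congr 1
  induction n with
  | zero => simp
  | succ n ih =>
    rw [Finset.prod_range_succ, ih, mul_add_one, Nat.factorial_succ, Nat.factorial_succ,
      Nat.factorial_succ]
    push_cast
    field_simp
    ring

lemma hasSum_besselJ_zero (x : ℝ) :
    HasSum (fun n : ℕ => (-1 : ℝ) ^ n * (x / 2) ^ (2 * n) / (n.factorial : ℝ) ^ 2)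
      (besselJ 0 x) := by
  have h := intervalIntegral.hasSum_integral_of_dominated_convergence (μ := volume)
    (a := 0) (b := π) (F := fun (n : ℕ) θ => (-1 : ℝ) ^ n * (x * sin θ) ^ (2 * n) / (2 * n).factorial)
    (f := fun θ => cos (x * sin θ)) (fun n _ => |x| ^ (2 * n) / (2 * n).factorial)
    (fun n => Continuous.aestronglyMeasurable (by fun_prop)) ?_ ?_ ?_ ?_
  · have h' := h.mul_left (1 / π)
    have hJ : besselJ 0 x = 1 / π * ∫ θ in (0 : ℝ)..π, cos (x * sin θ) := by
      simp [besselJ]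
    have hterm : ∀ n : ℕ, 1 / π * ∫ θ in (0 : ℝ)..π,
        (-1 : ℝ) ^ n * (x * sin θ) ^ (2 * n) / (2 * n).factorial =
          (-1) ^ n * (x / 2) ^ (2 * n) / (n.factorial : ℝ) ^ 2 := fun n => by
      have : ∀ θ : ℝ, (-1 : ℝ) ^ n * (x * sin θ) ^ (2 * n) / (2 * n).factorial =
          (-1) ^ n * x ^ (2 * n) / (2 * n).factorial * sin θ ^ (2 * n) := fun θ => by
        rw [mul_pow]
        ring
      simp only [this]
      rw [intervalIntegral.integral_const_mul, integral_sin_pow_even_eq_factorial]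
      have := pi_ne_zero
      have : ((2 * n).factorial : ℝ) ≠ 0 := by positivity
      rw [div_pow]
      field_simp
    simp only [hterm] at h'
    rwa [hJ]
  · refine fun n => Eventually.of_forall fun θ _ => ?_
    rw [norm_div, norm_mul, norm_pow, norm_neg, norm_one, one_pow, one_mul, norm_pow, norm_mul,
      norm_of_nonneg (Nat.cast_nonneg (α := ℝ) _), norm_eq_abs, norm_eq_abs]
    gcongr
    exact mul_le_of_le_one_right (abs_nonneg _) (abs_sin_le_one _)
  · refine Eventually.of_forall fun θ _ => ?_
    exact (summable_pow_div_factorial |x|).comp_injective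
      (mul_right_injective₀ (two_ne_zero (α := ℕ)))
  · exact intervalIntegrable_const
  · exact Eventually.of_forall fun θ _ => Real.hasSum_cos _

lemma integral_Ioi_eq_integral_exp (g : ℝ → ℝ) :
    ∫ t in Ioi (0 : ℝ), g t = ∫ s, exp s * g (exp s) := by
  have h := integral_image_eq_integral_abs_deriv_smul (s := univ) (f := exp) (f' := exp)
    MeasurableSet.univ (fun x _ => (hasDerivAt_exp x).hasDerivWithinAt) exp_injective.injOn g
  rw [image_univ, range_exp, setIntegral_univ] at h
  simpa using h

lemma integrable_exp_mul_comp_exp {g : ℝ → ℝ} (hg : IntegrableOn g (Ioi 0)) :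
    Integrable fun s => exp s * g (exp s) := by
  have h := integrableOn_image_iff_integrableOn_abs_deriv_smul (s := univ) (f := exp) (f' := exp)
    MeasurableSet.univ (fun x _ => (hasDerivAt_exp x).hasDerivWithinAt) exp_injective.injOn g
  rw [image_univ, range_exp, integrableOn_univ] at h
  simpa using h.1 hg

lemma integral_zpow_mul_exp_eq_besselK (n : ℕ) {a : ℝ} (ha : 0 < a) :
    ∫ t in Ioi (0 : ℝ), t ^ (-(n : ℤ) - 1) * exp (-(a / 2 / t) - a / 2 * t) =
      2 * besselK n a := by
  have key : ∀ s : ℝ, exp s * (exp s ^ (-(n : ℤ) - 1) *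
      exp (-(a / 2 / exp s) - a / 2 * exp s)) = exp (-(n * s)) * exp (-a * cosh s) := by
    intro s
    rw [← rpow_intCast, ← exp_mul, ← exp_add, ← exp_add, ← exp_add, cosh_eq, div_eq_mul_inv _ (exp s),
      ← exp_neg]
    push_cast
    ring_nf
  have hint := integrable_exp_mul_comp_exp
    (integrableOn_zpow_mul_exp (-(n : ℤ) - 1) (half_pos ha) (half_pos ha))
  rw [integral_Ioi_eq_integral_exp]
  simp only [key] at hint ⊢
  have hneg : IntegrableOn (fun s : ℝ => exp (-(n * -s)) * exp (-a * cosh (-s))) (Ioi 0) :=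
    (hint.comp_neg).integrableOn
  rw [← intervalIntegral.integral_Iic_add_Ioi (b := 0) hint.integrableOn hint.integrableOn,
    ← neg_zero, ← integral_comp_neg_Ioi, neg_zero, ← integral_add hneg hint.integrableOn, besselK,
    ← integral_const_mul]
  refine integral_congr_ae (Eventually.of_forall fun s => ?_)
  simp only [cosh_neg, cosh_eq (n * s)]
  ring_nf

lemma rotKernel_integral_swap {p : ℂ} {w c : ℝ → ℂ} (hw : Continuous w) (hc : Continuous c)
    (hc0 : ∀ θ, c θ ≠ 0) {M δ ε : ℝ} (hδ : 0 < δ) (hε : 0 < ε) (hM : ∀ θ, ‖(c θ)⁻¹‖ ≤ M)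
    (h1 : ∀ θ, δ ≤ (p * (c θ)⁻¹).re) (h2 : ∀ θ, ε ≤ (w θ * c θ).re) (x y : ℝ) :
    ∫ θ in x..y, ∫ t in Ioi (0 : ℝ), rotKernel p (w θ) (c θ) t =
      ∫ t in Ioi (0 : ℝ), ∫ θ in x..y, rotKernel p (w θ) (c θ) t := by
  refine intervalIntegral_integral_swap (f := fun θ t => rotKernel p (w θ) (c θ) t) ?_
  have : IsFiniteMeasure (volume.restrict (uIoc x y)) :=
    ⟨by rw [Measure.restrict_apply_univ, uIoc]; exact measure_Ioc_lt_top⟩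
  have hbound := ((integrableOn_zpow_mul_exp (-2) hδ hε).const_mul M).comp_snd
    (volume.restrict (uIoc x y))
  refine hbound.mono' ?_ ?_
  · rw [Measure.prod_restrict]
    refine ContinuousOn.aestronglyMeasurable ?_ (measurableSet_uIoc.prod measurableSet_Ioi)
    rintro ⟨θ, t⟩ ⟨-, ht⟩
    have ht : t ≠ 0 := ne_of_gt ht
    have h0 := hc0 θ
    unfold rotKernel Function.uncurry
    exact ContinuousAt.continuousWithinAt (by fun_prop (disch := simp_all))
  · rw [Measure.prod_restrict]
    filter_upwards [ae_restrict_mem (measurableSet_uIoc.prod measurableSet_Ioi)]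
    rintro ⟨θ, t⟩ ⟨-, ht⟩
    have ht : 0 < t := ht
    have hM0 : 0 ≤ M := (norm_nonneg _).trans (hM 0)
    simp only [Function.uncurry]
    rw [norm_rotKernel _ _ _ ht]
    gcongr
    · exact hM θ
    · exact h1 θ
    · exact h2 θ

lemma ofReal_sin_eq (θ : ℝ) : (sin θ : ℂ) =
    ((Complex.exp (Complex.I * θ))⁻¹ - Complex.exp (Complex.I * θ)) * Complex.I / 2 := by
  rw [Complex.ofReal_sin, Complex.sin, ← Complex.exp_neg]
  ring_nf

lemma sub_sin_mul_div {p a β q γ : ℝ} (h1 : a ^ 2 - β ^ 2 = 4 * p * q)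
    (h2 : a * β = 2 * p * γ) (θ : ℝ)
    (hne : (a + β * Complex.exp (-(Complex.I * θ)) : ℂ) ≠ 0) :
    (q - Complex.I * γ * sin θ) * (2 * p / (a + β * Complex.exp (-(Complex.I * θ)))) =
      (a - β * Complex.exp (Complex.I * θ)) / 2 := by
  have hE := Complex.exp_ne_zero (Complex.I * θ)
  rw [ofReal_sin_eq]
  rw [Complex.exp_neg] at *
  generalize Complex.exp (Complex.I * θ) = E at *
  have h1' : (a : ℂ) ^ 2 - β ^ 2 = 4 * p * q := by exact_mod_cast h1
  have h2' : (a : ℂ) * β = 2 * p * γ := by exact_mod_cast h2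
  rw [← mul_div_assoc, div_eq_iff hne]
  field_simp
  linear_combination (-E) * h1' + (E ^ 2 - 1) * h2' +
    2 * p * γ * (E ^ 2 - 1) * Complex.I_sq

lemma rotKernel_eq {p a β q γ : ℝ} (hp : 0 < p) (h1 : a ^ 2 - β ^ 2 = 4 * p * q)
    (h2 : a * β = 2 * p * γ) {t : ℝ} (ht : 0 < t) (θ : ℝ)
    (hne : (a + β * Complex.exp (-(Complex.I * θ)) : ℂ) ≠ 0) :
    rotKernel p (q - Complex.I * γ * sin θ) (2 * p / (a + β * Complex.exp (-(Complex.I * θ)))) t =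
      ((t ^ (-2 : ℤ) * exp (-(a / 2 / t) - a / 2 * t) / (2 * p) : ℝ) : ℂ) *
        (a * Complex.exp (β / 2 * (circleMap 0 t θ - (circleMap 0 t θ)⁻¹)) +
          β * t * ((circleMap 0 t θ)⁻¹ *
            Complex.exp (β / 2 * (circleMap 0 t θ - (circleMap 0 t θ)⁻¹)))) := by
  have ht' : (t : ℂ) ≠ 0 := by exact_mod_cast ht.ne'
  have hp' : (p : ℂ) ≠ 0 := by exact_mod_cast hp.ne'
  have hE := Complex.exp_ne_zero (Complex.I * θ)
  have hcm : circleMap 0 t θ = t * Complex.exp (Complex.I * θ) := by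
    simp [circleMap, mul_comm]
  rw [hcm, rotKernel, sub_sin_mul_div h1 h2 θ hne, inv_div]
  rw [Complex.exp_neg] at *
  generalize Complex.exp (Complex.I * θ) = E at *
  have he : Complex.exp (-(p * ((a + β * E⁻¹) / (2 * p)) / t) - (a - β * E) / 2 * t) =
      Complex.exp (-(a / 2 / t) - a / 2 * t) * Complex.exp (β / 2 * (t * E - (t * E)⁻¹)) := by
    rw [← Complex.exp_add]
    congr 1
    field_simp
    ring
  rw [he]
  push_cast
  field_simp

lemma integral_circle_exp (β : ℝ) {t : ℝ} (ht : 0 < t) :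
    ∫ θ in (0 : ℝ)..2 * π, Complex.exp (β / 2 * (circleMap 0 t θ - (circleMap 0 t θ)⁻¹)) =
      2 * π * besselJ 0 β := by
  rw [integral_circleMap_eq_of_differentiable
    (f := fun z => Complex.exp (β / 2 * (z - z⁻¹))) (fun z hz => by fun_prop (disch := assumption))
    one_pos ht, ← besselJ_eq_integral_cexp]
  refine intervalIntegral.integral_congr fun θ _ => ?_
  simp only [circleMap, Complex.ofReal_sin, Complex.sin]
  rw [zero_add, Complex.ofReal_one, one_mul, ← Complex.exp_neg]
  congr 1
  push_cast
  rw [neg_mul]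
  linear_combination (β / 2 * (Complex.exp (θ * Complex.I) - Complex.exp (-(θ * Complex.I)))) *
    Complex.I_sq

lemma integral_circle_inv_mul_exp (β : ℝ) {t : ℝ} (ht : 0 < t) :
    ∫ θ in (0 : ℝ)..2 * π, (circleMap 0 t θ)⁻¹ *
      Complex.exp (β / 2 * (circleMap 0 t θ - (circleMap 0 t θ)⁻¹)) = 2 * π * besselJ 1 β := by
  rw [integral_circleMap_eq_of_differentiable
    (f := fun z => z⁻¹ * Complex.exp (β / 2 * (z - z⁻¹)))
    (fun z hz => by fun_prop (disch := assumption))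
    one_pos ht, ← besselJ_eq_integral_cexp]
  refine intervalIntegral.integral_congr fun θ _ => ?_
  simp only [circleMap, Complex.ofReal_sin, Complex.sin]
  rw [zero_add, Complex.ofReal_one, one_mul, ← Complex.exp_neg, ← Complex.exp_add]
  congr 1
  push_cast
  rw [neg_mul]
  linear_combination (β / 2 * (Complex.exp (θ * Complex.I) - Complex.exp (-(θ * Complex.I)))) *
    Complex.I_sq

lemma integral_rotKernel_circle {p a β q γ : ℝ} (hp : 0 < p) (h1 : a ^ 2 - β ^ 2 = 4 * p * q)
    (h2 : a * β = 2 * p * γ) {t : ℝ} (ht : 0 < t)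
    (hne : ∀ θ : ℝ, (a + β * Complex.exp (-(Complex.I * θ)) : ℂ) ≠ 0) :
    ∫ θ in (0 : ℝ)..2 * π, rotKernel p (q - Complex.I * γ * sin θ)
        (2 * p / (a + β * Complex.exp (-(Complex.I * θ)))) t =
      ((π / p * (a * besselJ 0 β * (t ^ (-2 : ℤ) * exp (-(a / 2 / t) - a / 2 * t)) +
        β * besselJ 1 β * (t ^ (-1 : ℤ) * exp (-(a / 2 / t) - a / 2 * t))) : ℝ) : ℂ) := by
  simp only [rotKernel_eq hp h1 h2 ht _ (hne _)]
  have hcm : ∀ θ : ℝ, circleMap 0 t θ ≠ 0 := fun θ => by simp [circleMap, ht.ne']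
  rw [intervalIntegral.integral_const_mul, intervalIntegral.integral_add,
    intervalIntegral.integral_const_mul, intervalIntegral.integral_const_mul,
    integral_circle_exp β ht, integral_circle_inv_mul_exp β ht]
  · have ht' : (t : ℂ) ≠ 0 := by exact_mod_cast ht.ne'
    have hp' : (p : ℂ) ≠ 0 := by exact_mod_cast hp.ne'
    simp only [zpow_neg]
    norm_cast
    field_simp
  · exact Continuous.intervalIntegrable (by fun_prop (disch := exact hcm _)) _ _
  · exact Continuous.intervalIntegrable (by fun_prop (disch := exact hcm _)) _ _

/-- The Laplace transform of `t⁻² * exp (-p / t) * J₀(γ t)` as a product of Bessel functions. -/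
lemma integral_besselJ_eq {p a β q γ : ℝ} (hp : 0 < p) (hq : 0 < q) (hβ : 0 < β) (hβa : β < a)
    (h1 : a ^ 2 - β ^ 2 = 4 * p * q) (h2 : a * β = 2 * p * γ) :
    ∫ t in Ioi (0 : ℝ), t ^ (-2 : ℤ) * exp (-(p / t) - q * t) * besselJ 0 (γ * t) =
      (a * besselJ 0 β * besselK 1 a + β * besselJ 1 β * besselK 0 a) / p := by
  have hp' : (p : ℂ) ≠ 0 := by exact_mod_cast hp.ne'
  set w : ℝ → ℂ := fun θ => q - Complex.I * γ * sin θ with hw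
  set u : ℝ → ℂ := fun θ => a + β * Complex.exp (-(Complex.I * θ)) with hu
  set c : ℝ → ℂ := fun θ => 2 * p / u θ with hc
  have hnE : ∀ θ : ℝ, ‖Complex.exp (-(Complex.I * θ))‖ = 1 := fun θ => by
    simp [Complex.norm_exp]
  have hure : ∀ θ, a - β ≤ (u θ).re := fun θ => by
    have := neg_le_of_abs_le ((Complex.abs_re_le_norm _).trans (hnE θ).le)
    simp only [hu, Complex.add_re, Complex.ofReal_re, Complex.re_ofReal_mul]
    nlinarith
  have hne : ∀ θ, u θ ≠ 0 := fun θ h => by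
    have := hure θ
    rw [h, Complex.zero_re] at this
    linarith
  have hpc : ∀ θ, p * (c θ)⁻¹ = u θ / 2 := fun θ => by
    simp only [hc, inv_div]
    field_simp
  have hwc : ∀ θ, w θ * c θ = (a - β * Complex.exp (Complex.I * θ)) / 2 := fun θ =>
    sub_sin_mul_div h1 h2 θ (hne θ)
  have hwcre : ∀ θ, (a - β) / 2 ≤ (w θ * c θ).re := fun θ => by
    have h3 : ‖Complex.exp (Complex.I * θ)‖ = 1 := by simp [Complex.norm_exp]
    have := le_of_abs_le ((Complex.abs_re_le_norm _).trans h3.le)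
    rw [hwc, Complex.div_ofNat_re, Complex.sub_re, Complex.ofReal_re, Complex.re_ofReal_mul]
    nlinarith
  have hpcre : ∀ θ, (a - β) / 2 ≤ (p * (c θ)⁻¹).re := fun θ => by
    rw [hpc, Complex.div_ofNat_re]
    linarith [hure θ]
  have hcre : ∀ θ, 0 < (c θ).re := fun θ => by
    have h3 : 0 < ((c θ)⁻¹).re := by
      have := hpcre θ
      rw [Complex.re_ofReal_mul] at this
      exact pos_of_mul_pos_right (by linarith) hp.le
    rw [Complex.inv_re] at h3
    exact (div_pos_iff_of_pos_right (Complex.normSq_pos.2 (by simp [hc, hne, hp']))).1 h3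
  have hwre : ∀ θ, (w θ).re = q := fun θ => by simp [hw]
  have hcinv : ∀ θ, ‖(c θ)⁻¹‖ ≤ (a + β) / (2 * p) := fun θ => by
    have h3 : ‖u θ‖ ≤ a + β := by
      refine (norm_add_le _ _).trans ?_
      rw [norm_mul, hnE, Complex.norm_real, Complex.norm_real, norm_of_nonneg (by linarith),
        norm_of_nonneg hβ.le, mul_one]
    simp only [hc, inv_div, norm_div, norm_mul, Complex.norm_real, Complex.norm_ofNat]
    rw [norm_of_nonneg hp.le]
    gcongr
  have hwcont : Continuous w := by fun_prop
  have hccont : Continuous c := by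
    simp only [hc]
    exact continuous_const.div (by fun_prop) hne
  have e1 := rotKernel_integral_swap (p := p) hwcont hccont
    (fun θ => by simp [hc, hne, hp']) (by linarith : 0 < (a - β) / 2)
    (by linarith : 0 < (a - β) / 2) hcinv hpcre hwcre 0 (2 * π)
  have e2 := rotKernel_integral_swap (p := p) (c := fun _ => 1) hwcont continuous_const
    (fun θ => one_ne_zero) hp hq (M := 1) (fun θ => by simp) (fun θ => by simp)
    (fun θ => by simp [hwre]) 0 (2 * π)
  have e3 : ∀ θ, ∫ t in Ioi (0 : ℝ), rotKernel p (w θ) (c θ) t =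
      ∫ t in Ioi (0 : ℝ), rotKernel p (w θ) 1 t := fun θ =>
    integral_rotKernel_eq hp (by rw [hwre]; exact hq) (hcre θ)
      (lt_of_lt_of_le (by linarith) (hwcre θ))
  simp only [e3] at e1
  rw [e2] at e1
  have e4 : ∫ t in Ioi (0 : ℝ), ∫ θ in (0 : ℝ)..2 * π, rotKernel p (w θ) 1 t =
      ∫ t in Ioi (0 : ℝ), ((2 * π * (t ^ (-2 : ℤ) * exp (-(p / t) - q * t) *
        besselJ 0 (γ * t)) : ℝ) : ℂ) := by
    refine setIntegral_congr_fun measurableSet_Ioi fun t ht => ?_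
    have h3 := besselJ_eq_integral_cexp 0 (γ * t)
    have : ∀ θ, rotKernel p (w θ) 1 t = ((t ^ (-2 : ℤ) * exp (-(p / t) - q * t) : ℝ) : ℂ) *
        Complex.exp (-(Complex.I * (((0 : ℤ) : ℂ) * θ - (γ * t : ℝ) * sin θ))) := fun θ => by
      rw [rotKernel]
      push_cast
      rw [inv_one, one_mul, mul_assoc (_ ^ _) (Complex.exp _), ← Complex.exp_add]
      congr 2
      simp only [hw]
      push_cast
      ring
    simp only [this]
    rw [intervalIntegral.integral_const_mul, h3]
    push_cast
    ring
  have e5 : ∫ t in Ioi (0 : ℝ), ∫ θ in (0 : ℝ)..2 * π, rotKernel p (w θ) (c θ) t =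
      ∫ t in Ioi (0 : ℝ), ((π / p * (a * besselJ 0 β *
        (t ^ (-2 : ℤ) * exp (-(a / 2 / t) - a / 2 * t)) +
        β * besselJ 1 β * (t ^ (-1 : ℤ) * exp (-(a / 2 / t) - a / 2 * t))) : ℝ) : ℂ) :=
    setIntegral_congr_fun measurableSet_Ioi fun t ht =>
      integral_rotKernel_circle hp h1 h2 ht hne
  rw [e4, e5, integral_complex_ofReal, integral_complex_ofReal, Complex.ofReal_inj, integral_const_mul,
    integral_const_mul] at e1
  have ha : 0 < a := hβ.trans hβa
  have hk1 : ∫ t in Ioi (0 : ℝ), t ^ (-2 : ℤ) * exp (-(a / 2 / t) - a / 2 * t) =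
      2 * besselK 1 a := by
    simpa only [Nat.cast_one, Int.reduceNeg, Int.reduceSub] using
      integral_zpow_mul_exp_eq_besselK 1 ha
  have hk0 : ∫ t in Ioi (0 : ℝ), t ^ (-1 : ℤ) * exp (-(a / 2 / t) - a / 2 * t) =
      2 * besselK 0 a := by
    simpa only [Nat.cast_zero, neg_zero, zero_sub] using integral_zpow_mul_exp_eq_besselK 0 ha
  rw [integral_add, integral_const_mul, integral_const_mul, hk1, hk0] at e1
  · have := pi_pos
    rw [eq_div_iff hp.ne']
    refine mul_left_cancel₀ (by positivity : 2 * π / p ≠ 0) (Eq.trans ?_ (e1.trans ?_))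
    · rw [mul_comm _ p, ← mul_assoc, div_mul_cancel₀ _ hp.ne']
    · ring
  · exact (integrableOn_zpow_mul_exp _ (half_pos ha) (half_pos ha)).const_mul _
  · exact (integrableOn_zpow_mul_exp _ (half_pos ha) (half_pos ha)).const_mul _

lemma sqrt_pair {p γ q : ℝ} (hp : 0 < p) (hγ : 0 < γ) (hq : 0 < q) :
    let a := √(2 * p) * √(√(q ^ 2 + γ ^ 2) + q)
    let β := √(2 * p) * √(√(q ^ 2 + γ ^ 2) - q)
    0 < β ∧ β < a ∧ a ^ 2 - β ^ 2 = 4 * p * q ∧ a * β = 2 * p * γ := by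
  intro a β
  have hs : q < √(q ^ 2 + γ ^ 2) := lt_sqrt_of_sq_lt (by nlinarith)
  have h2p : 0 < √(2 * p) := sqrt_pos.2 (by linarith)
  refine ⟨mul_pos h2p (sqrt_pos.2 (by linarith)),
    mul_lt_mul_of_pos_left (sqrt_lt_sqrt (by linarith) (by linarith)) h2p, ?_, ?_⟩
  · simp only [a, β, mul_pow]
    rw [sq_sqrt (by linarith), sq_sqrt (by linarith), sq_sqrt (by linarith)]
    ring
  · have h : √(√(q ^ 2 + γ ^ 2) + q) * √(√(q ^ 2 + γ ^ 2) - q) = γ := by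
      rw [← sqrt_mul (by linarith), sqrt_eq_iff_mul_self_eq_of_pos hγ]
      nlinarith [sq_sqrt (show 0 ≤ q ^ 2 + γ ^ 2 by positivity)]
    calc a * β = √(2 * p) ^ 2 * (√(√(q ^ 2 + γ ^ 2) + q) * √(√(q ^ 2 + γ ^ 2) - q)) := by
          simp only [a, β]
          ring
      _ = 2 * p * γ := by rw [h, sq_sqrt (by linarith)]

lemma besselJ_mul_besselK_eq_integral {p γ q : ℝ} (hp : 0 < p) (hγ : 0 < γ) (hq : 0 < q) :
    besselJ 1 (√(2 * p) * √(√(q ^ 2 + γ ^ 2) - q)) *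
          besselK 0 (√(2 * p) * √(√(q ^ 2 + γ ^ 2) + q)) /
          (√(2 * p) * √(√(q ^ 2 + γ ^ 2) + q)) +
        besselJ 0 (√(2 * p) * √(√(q ^ 2 + γ ^ 2) - q)) *
          besselK 1 (√(2 * p) * √(√(q ^ 2 + γ ^ 2) + q)) /
          (√(2 * p) * √(√(q ^ 2 + γ ^ 2) - q)) =
      1 / (2 * γ) * ∫ t in Ioi (0 : ℝ), t ^ (-2 : ℤ) * exp (-(p / t) - q * t) *
        besselJ 0 (γ * t) := by
  obtain ⟨hβ, hβa, h1, h2⟩ := sqrt_pair hp hγ hq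
  set a := √(2 * p) * √(√(q ^ 2 + γ ^ 2) + q)
  set β := √(2 * p) * √(√(q ^ 2 + γ ^ 2) - q)
  have ha : 0 < a := hβ.trans hβa
  rw [integral_besselJ_eq hp hq hβ hβa h1 h2, div_add_div _ _ ha.ne' hβ.ne', h2]
  field_simp
  ring

lemma iteratedDeriv_besselJ_mul_besselK {p γ q : ℝ} (hp : 0 < p) (hγ : 0 < γ) (hq : 0 < q) :
    iteratedDeriv 3 (fun q : ℝ =>
      besselJ 1 (√(2 * p) * √(√(q ^ 2 + γ ^ 2) - q)) *
          besselK 0 (√(2 * p) * √(√(q ^ 2 + γ ^ 2) + q)) /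
          (√(2 * p) * √(√(q ^ 2 + γ ^ 2) + q)) +
        besselJ 0 (√(2 * p) * √(√(q ^ 2 + γ ^ 2) - q)) *
          besselK 1 (√(2 * p) * √(√(q ^ 2 + γ ^ 2) + q)) /
          (√(2 * p) * √(√(q ^ 2 + γ ^ 2) - q))) q =
      -(1 / (2 * γ)) * ∫ t in Ioi (0 : ℝ), t * exp (-(p / t) - q * t) * besselJ 0 (γ * t) := by
  rw [Filter.EventuallyEq.iteratedDeriv_eq 3 (eventually_of_mem (Ioi_mem_nhds hq) fun q hq =>
      besselJ_mul_besselK_eq_integral hp hγ hq), iteratedDeriv_const_mul_field,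
    iteratedDeriv_laplace (-2) hp hq (f := fun t => besselJ 0 (γ * t))
      ((continuous_besselJ 0).comp (continuous_const_mul γ)) fun t => abs_besselJ_le_one 0 _]
  norm_num

lemma integral_pow_mul_exp_neg (n : ℕ) {q : ℝ} (hq : 0 < q) :
    ∫ t in Ioi (0 : ℝ), t ^ n * exp (-(q * t)) = n.factorial / q ^ (n + 1) := by
  have h := integral_rpow_mul_exp_neg_mul_Ioi (a := n + 1) (by positivity) hq
  rw [Gamma_nat_eq_factorial, add_sub_cancel_right] at h
  simp only [rpow_natCast] at h
  rw [h, ← Nat.cast_add_one, rpow_natCast]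
  ring

lemma hasSum_exp_neg_add_one_mul {t : ℝ} (ht : 0 < t) :
    HasSum (fun k : ℕ => exp (-((k + 1) * t))) (exp t - 1)⁻¹ := by
  have h := (hasSum_geometric_of_lt_one (exp_pos (-t)).le
    (exp_lt_one_iff.2 (neg_lt_zero.2 ht))).mul_left (exp (-t))
  have h1 : exp (-t) * (1 - exp (-t))⁻¹ = (exp t - 1)⁻¹ := by
    rw [exp_neg, ← mul_inv, mul_sub, mul_inv_cancel₀ (exp_ne_zero _), mul_one]
  have h2 : ∀ k : ℕ, exp (-t) * exp (-t) ^ k = exp (-((k + 1) * t)) := fun k => by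
    rw [← exp_nat_mul, ← exp_add]
    ring_nf
  simpa only [h1, h2] using h

lemma hasSum_integral_mul_exp_mul_besselJ {p : ℝ} (hp : 0 < p) (γ : ℝ) :
    HasSum (fun k : ℕ => ∫ t in Ioi (0 : ℝ), t * exp (-(p / t) - (k + 1) * t) *
        besselJ 0 (γ * t))
      (∫ t in Ioi (0 : ℝ), t * exp (-(p / t)) / (exp t - 1) * besselJ 0 (γ * t)) := by
  have hint : ∀ k : ℕ, IntegrableOn (fun t : ℝ => t * exp (-(p / t) - (k + 1) * t) *
      besselJ 0 (γ * t)) (Ioi 0) := fun k => by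
    have h := integrableOn_zpow_mul_exp 1 hp (by positivity : (0 : ℝ) < k + 1)
    simp only [zpow_one] at h
    exact h.mul_bdd (c := 1)
      ((continuous_besselJ 0).comp (continuous_const_mul γ)).aestronglyMeasurable
      (Eventually.of_forall fun t => abs_besselJ_le_one 0 _)
  have hsum : Summable fun k : ℕ => ∫ t in Ioi (0 : ℝ),
      ‖t * exp (-(p / t) - (k + 1) * t) * besselJ 0 (γ * t)‖ := by
    refine Summable.of_nonneg_of_le (fun k => integral_nonneg fun t => norm_nonneg _)
      (fun k => ?_) ((summable_nat_add_iff 1).2 (Real.summable_one_div_nat_pow.2 one_lt_two))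
    have hk : (0 : ℝ) < k + 1 := by positivity
    have h1 := integral_pow_mul_exp_neg 1 hk
    have h2 := integrableOn_pow_mul_exp_neg 1 hk
    simp only [pow_one, Nat.factorial_one, Nat.cast_one, one_add_one_eq_two] at h1 h2
    push_cast
    rw [← h1]
    refine setIntegral_mono_on (hint k).norm h2 measurableSet_Ioi fun t ht => ?_
    rw [norm_mul, norm_mul, norm_of_nonneg (le_of_lt ht), norm_of_nonneg (exp_pos _).le]
    refine (mul_le_of_le_one_right (mul_nonneg (le_of_lt ht) (exp_pos _).le)
      (abs_besselJ_le_one 0 _)).trans (mul_le_mul_of_nonneg_left (exp_le_exp.2 ?_) (le_of_lt ht))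
    have : 0 ≤ p / t := div_nonneg hp.le (le_of_lt ht)
    linarith
  have htsum : ∀ t ∈ Ioi (0 : ℝ), ∑' k : ℕ, t * exp (-(p / t) - (k + 1) * t) *
      besselJ 0 (γ * t) = t * exp (-(p / t)) / (exp t - 1) * besselJ 0 (γ * t) := fun t ht => by
    have h := ((hasSum_exp_neg_add_one_mul ht).mul_left (t * exp (-(p / t)))).mul_right
      (besselJ 0 (γ * t))
    simpa only [sub_eq_add_neg, exp_add, mul_assoc, div_eq_mul_inv] using h.tsum_eq
  have h := hasSum_integral_of_summable_integral_norm hint hsum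
  rwa [setIntegral_congr_fun measurableSet_Ioi htsum] at h

lemma Gamma_half_add_div (n : ℕ) :
    Real.Gamma (1 / 2 + n + 1) / (n.factorial * Real.Gamma (1 / 2 + 1)) =
      (2 * n + 1).factorial / (4 ^ n * (n.factorial : ℝ) ^ 2) := by
  have h0 : Real.Gamma (1 / 2 + 1) ≠ 0 := (Real.Gamma_pos_of_pos (by norm_num)).ne'
  induction n with
  | zero =>
    rw [Nat.cast_zero, add_zero, Nat.factorial_zero, Nat.cast_one, one_mul, div_self h0]
    simp
  | succ n ih =>
    rw [Real.Gamma_add_one (by positivity), show (1 / 2 + ((n + 1 : ℕ) : ℝ)) = 1 / 2 + n + 1 by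
      push_cast
      ring]
    rw [div_eq_iff (by positivity)] at ih
    rw [ih, show 2 * (n + 1) + 1 = 2 * n + 1 + 1 + 1 by ring, Nat.factorial_succ n,
      Nat.factorial_succ (2 * n + 1 + 1), Nat.factorial_succ (2 * n + 1)]
    push_cast
    field_simp
    ring

lemma mathieu_term_eq (p γ : ℝ) (n : ℕ) :
    (-1 : ℝ) ^ n * (Real.Gamma (1 / 2 + n + 1) / (n.factorial * Real.Gamma (1 / 2 + 1))) *
        zetaP p (2 * (1 / 2) + 2 * n + 1) * γ ^ (2 * n) =
      ∫ t in Ioi (0 : ℝ), t * exp (-(p / t)) / (exp t - 1) *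
        ((-1) ^ n * (γ * t / 2) ^ (2 * n) / (n.factorial : ℝ) ^ 2) := by
  have h1 : (2 * (1 / 2) + 2 * n + 1 : ℝ) = (2 * n + 1 : ℕ) + 1 := by
    push_cast
    ring
  rw [Gamma_half_add_div, zetaP, h1, Gamma_nat_eq_factorial, add_sub_cancel_right]
  have h2 : ∀ t : ℝ, t * exp (-(p / t)) / (exp t - 1) *
      ((-1) ^ n * (γ * t / 2) ^ (2 * n) / (n.factorial : ℝ) ^ 2) =
      (-1) ^ n * γ ^ (2 * n) / (4 ^ n * (n.factorial : ℝ) ^ 2) *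
        (t ^ ((2 * n + 1 : ℕ) : ℝ) * exp (-p / t) / (exp t - 1)) := fun t => by
    rw [rpow_natCast, neg_div, div_pow, mul_pow, pow_succ, pow_mul 2 2 n]
    norm_num
    ring
  simp only [h2]
  rw [integral_const_mul]
  field_simp

lemma mul_exp_neg_div_exp_sub_one_le {p t : ℝ} (hp : 0 ≤ p) (ht : 0 < t) :
    t * exp (-(p / t)) / (exp t - 1) ≤ (1 + t) * exp (-t) := by
  have h1 : 0 < exp t - 1 := sub_pos.2 (one_lt_exp_iff.2 ht)
  have h2 : exp (-(p / t)) ≤ 1 := exp_le_one_iff.2 (neg_nonpos.2 (div_nonneg hp ht.le))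
  rw [div_le_iff₀ h1]
  calc t * exp (-(p / t)) ≤ t := mul_le_of_le_one_right ht.le h2
    _ ≤ 1 + t - (1 + t) * exp (-t) := by
      have := add_one_le_exp t
      have h3 : exp t * exp (-t) = 1 := by rw [← exp_add, add_neg_cancel, exp_zero]
      nlinarith [exp_pos (-t)]
    _ = (1 + t) * exp (-t) * (exp t - 1) := by
      have h3 : exp (-t) * exp t = 1 := by rw [← exp_add, neg_add_cancel, exp_zero]
      linear_combination (-(1 + t)) * h3

lemma hasSum_mathieu_integral {p γ : ℝ} (hp : 0 < p) (hγ0 : 0 < γ) (hγ1 : γ < 1) :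
    HasSum (fun n : ℕ => ∫ t in Ioi (0 : ℝ), t * exp (-(p / t)) / (exp t - 1) *
        ((-1) ^ n * (γ * t / 2) ^ (2 * n) / (n.factorial : ℝ) ^ 2))
      (∫ t in Ioi (0 : ℝ), t * exp (-(p / t)) / (exp t - 1) * besselJ 0 (γ * t)) := by
  have hle : ∀ n : ℕ, ∀ t ∈ Ioi (0 : ℝ), ‖t * exp (-(p / t)) / (exp t - 1) *
      ((-1) ^ n * (γ * t / 2) ^ (2 * n) / (n.factorial : ℝ) ^ 2)‖ ≤
      γ ^ (2 * n) / (4 ^ n * (n.factorial : ℝ) ^ 2) *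
        (t ^ (2 * n) * exp (-(1 * t)) + t ^ (2 * n + 1) * exp (-(1 * t))) := fun n t ht => by
    have ht' : 0 < t := ht
    have h1 : 0 < exp t - 1 := sub_pos.2 (one_lt_exp_iff.2 ht)
    have h2 : ‖(-1 : ℝ) ^ n * (γ * t / 2) ^ (2 * n) / (n.factorial : ℝ) ^ 2‖ =
        γ ^ (2 * n) / (4 ^ n * (n.factorial : ℝ) ^ 2) * t ^ (2 * n) := by
      rw [norm_div, norm_mul, norm_pow, norm_neg, norm_one, one_pow, one_mul,
        norm_of_nonneg (by positivity), norm_of_nonneg (by positivity), div_pow, mul_pow,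
        pow_mul 2 2 n]
      norm_num
      ring
    rw [norm_mul, h2, norm_of_nonneg (by positivity)]
    refine (mul_le_mul_of_nonneg_right (mul_exp_neg_div_exp_sub_one_le hp.le ht')
      (by positivity)).trans_eq ?_
    rw [one_mul]
    ring
  have hdom : ∀ n : ℕ, IntegrableOn (fun t : ℝ => γ ^ (2 * n) / (4 ^ n * (n.factorial : ℝ) ^ 2) *
      (t ^ (2 * n) * exp (-(1 * t)) + t ^ (2 * n + 1) * exp (-(1 * t)))) (Ioi 0) := fun n =>
    ((integrableOn_pow_mul_exp_neg _ one_pos).add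
      (integrableOn_pow_mul_exp_neg _ one_pos)).const_mul _
  have hint : ∀ n : ℕ, IntegrableOn (fun t : ℝ => t * exp (-(p / t)) / (exp t - 1) *
      ((-1) ^ n * (γ * t / 2) ^ (2 * n) / (n.factorial : ℝ) ^ 2)) (Ioi 0) := fun n =>
    (hdom n).mono' (Measurable.aestronglyMeasurable (by fun_prop))
      ((ae_restrict_iff' measurableSet_Ioi).2 (Eventually.of_forall (hle n)))
  have hsum : Summable fun n : ℕ => ∫ t in Ioi (0 : ℝ), ‖t * exp (-(p / t)) / (exp t - 1) *
      ((-1) ^ n * (γ * t / 2) ^ (2 * n) / (n.factorial : ℝ) ^ 2)‖ := by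
    have hγ2 : ‖γ ^ 2‖ < 1 := by
      rw [norm_pow, norm_of_nonneg hγ0.le]
      exact pow_lt_one₀ hγ0.le hγ1 two_ne_zero
    refine Summable.of_nonneg_of_le (fun n => integral_nonneg fun t => norm_nonneg _)
      (fun n => ?_) (((summable_pow_mul_geometric_of_norm_lt_one 1 hγ2).add
        (summable_geometric_of_norm_lt_one hγ2)).mul_left 2)
    refine (setIntegral_mono_on (hint n).norm (hdom n) measurableSet_Ioi (hle n)).trans ?_
    rw [integral_const_mul, integral_add (integrableOn_pow_mul_exp_neg _ one_pos)
      (integrableOn_pow_mul_exp_neg _ one_pos), integral_pow_mul_exp_neg _ one_pos,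
      integral_pow_mul_exp_neg _ one_pos, one_pow, one_pow, div_one, div_one]
    have hc : ((2 * n).factorial : ℝ) ≤ 4 ^ n * (n.factorial : ℝ) ^ 2 := by
      have h1 := Nat.choose_mul_factorial_mul_factorial (show n ≤ 2 * n by omega)
      have h2 := Nat.choose_le_two_pow (2 * n) n
      rw [show 2 * n - n = n by omega] at h1
      rw [← h1, show (4 : ℝ) ^ n = 2 ^ (2 * n) by rw [pow_mul]; norm_num]
      push_cast
      rw [mul_assoc, ← sq]
      gcongr
      exact_mod_cast h2
    rw [Nat.factorial_succ, div_mul_eq_mul_div, div_le_iff₀ (by positivity), ← pow_mul]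
    push_cast
    calc γ ^ (2 * n) * ((2 * n).factorial + (2 * n + 1) * (2 * n).factorial)
        = 2 * (n ^ 1 * γ ^ (2 * n) + γ ^ (2 * n)) * (2 * n).factorial := by ring
      _ ≤ _ := by gcongr
  have h := hasSum_integral_of_summable_integral_norm hint hsum
  rwa [setIntegral_congr_fun measurableSet_Ioi fun t _ =>
    ((hasSum_besselJ_zero (γ * t)).mul_left _).tsum_eq] at h

theorem stmt1 (p γ : ℝ) (hp : 0 < p) (hγ0 : 0 < γ) (hγ1 : γ < 1) :
    mathieuS (1/2) p γ =
      -4 * γ *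
        ∑' k : ℕ, iteratedDeriv 3
          (fun q : ℝ =>
            besselJ 1 (Real.sqrt (2 * p) * Real.sqrt (Real.sqrt (q ^ 2 + γ ^ 2) - q)) *
                besselK 0 (Real.sqrt (2 * p) * Real.sqrt (Real.sqrt (q ^ 2 + γ ^ 2) + q)) /
                (Real.sqrt (2 * p) * Real.sqrt (Real.sqrt (q ^ 2 + γ ^ 2) + q)) +
              besselJ 0 (Real.sqrt (2 * p) * Real.sqrt (Real.sqrt (q ^ 2 + γ ^ 2) - q)) *
                besselK 1 (Real.sqrt (2 * p) * Real.sqrt (Real.sqrt (q ^ 2 + γ ^ 2) + q)) /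
                (Real.sqrt (2 * p) * Real.sqrt (Real.sqrt (q ^ 2 + γ ^ 2) - q)))
          (k + 1) := by
  have hk : ∀ k : ℕ, (0 : ℝ) < k + 1 := fun k => by positivity
  rw [mathieuS]
  simp only [mathieu_term_eq]
  rw [(hasSum_mathieu_integral hp hγ0 hγ1).tsum_eq]
  simp only [fun k => iteratedDeriv_besselJ_mul_besselK hp hγ0 (hk k)]
  rw [tsum_mul_left, (hasSum_integral_mul_exp_mul_besselJ hp γ).tsum_eq]
  rw [← mul_assoc]
  congr 1
  field_simp
  norm_num
end

section
/- Let p > 0 and 0 < γ < 1. Define H : (0,∞) → ℝ by H(q) = J_1(z₋(q)) K_1(z₊(q)), where z_±(q) = √(2p)·(√(q²+γ²) ± q)^{1/2}. Then S_{−1/2, p}(γ) = 4γ ∑_{k≥1} H'(k), where H' denotes the derivative of H. -/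
open Real MeasureTheory

/-- The normalized cosine moment `(1/π) ∫₀^π g(θ) cos(x sin θ) dθ`. -/
noncomputable def cosMoment (g : ℝ → ℝ) (x : ℝ) : ℝ :=
  (1 / π) * ∫ θ in (0:ℝ)..π, g θ * cos (x * sin θ)

/-- The normalized sine moment `(1/π) ∫₀^π g(θ) sin(x sin θ) dθ`. -/
noncomputable def sinMoment (g : ℝ → ℝ) (x : ℝ) : ℝ :=
  (1 / π) * ∫ θ in (0:ℝ)..π, g θ * sin (x * sin θ)

lemma hasDerivAt_cosMoment {g : ℝ → ℝ} (hg : Continuous g) (x : ℝ) :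
    HasDerivAt (cosMoment g) (-sinMoment (fun θ => g θ * sin θ) x) x := by
  have h := (intervalIntegral.hasDerivAt_integral_of_dominated_loc_of_deriv_le
    (μ := volume) (a := 0) (b := π) (bound := fun θ => |g θ|)
    (F := fun x θ => g θ * cos (x * sin θ))
    (F' := fun x θ => -(g θ * sin θ * sin (x * sin θ))) (x₀ := x) Filter.univ_mem
    (.of_forall fun y => (by fun_prop : Continuous _).aestronglyMeasurable)
    ((by fun_prop : Continuous _).intervalIntegrable _ _)
    (by fun_prop : Continuous _).aestronglyMeasurable
    (.of_forall fun θ _ y _ => by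
      rw [norm_eq_abs, abs_neg, abs_mul, abs_mul, mul_assoc]
      exact mul_le_of_le_one_right (abs_nonneg _)
        (mul_le_one₀ (abs_sin_le_one _) (abs_nonneg _) (abs_sin_le_one _)))
    (hg.abs.intervalIntegrable _ _)
    (.of_forall fun θ _ y _ => by
      have := (((hasDerivAt_id y).mul_const (sin θ)).cos).const_mul (g θ)
      refine this.congr_deriv ?_
      simp only [id]; ring)).2
  refine (h.const_mul (1 / π)).congr_deriv ?_
  rw [intervalIntegral.integral_neg, sinMoment]; ring

lemma hasDerivAt_sinMoment {g : ℝ → ℝ} (hg : Continuous g) (x : ℝ) :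
    HasDerivAt (sinMoment g) (cosMoment (fun θ => g θ * sin θ) x) x := by
  have h := (intervalIntegral.hasDerivAt_integral_of_dominated_loc_of_deriv_le
    (μ := volume) (a := 0) (b := π) (bound := fun θ => |g θ|)
    (F := fun x θ => g θ * sin (x * sin θ))
    (F' := fun x θ => g θ * sin θ * cos (x * sin θ)) (x₀ := x) Filter.univ_mem
    (.of_forall fun y => (by fun_prop : Continuous _).aestronglyMeasurable)
    ((by fun_prop : Continuous _).intervalIntegrable _ _)
    (by fun_prop : Continuous _).aestronglyMeasurable
    (.of_forall fun θ _ y _ => by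
      rw [norm_eq_abs, abs_mul, abs_mul, mul_assoc]
      exact mul_le_of_le_one_right (abs_nonneg _)
        (mul_le_one₀ (abs_sin_le_one _) (abs_nonneg _) (abs_cos_le_one _)))
    (hg.abs.intervalIntegrable _ _)
    (.of_forall fun θ _ y _ => by
      have := (((hasDerivAt_id y).mul_const (sin θ)).sin).const_mul (g θ)
      refine this.congr_deriv ?_
      simp only [id]; ring)).2
  exact h.const_mul (1 / π)

lemma abs_normalized_integral_le_one {f : ℝ → ℝ} (hf : ∀ θ, |f θ| ≤ 1) :
    |(1 / π) * ∫ θ in (0:ℝ)..π, f θ| ≤ 1 := by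
  have h := intervalIntegral.norm_integral_le_of_norm_le_const (a := 0) (b := π) (f := f) (C := 1)
    (fun θ _ => hf θ)
  rw [norm_eq_abs, sub_zero, abs_of_pos pi_pos, one_mul] at h
  rw [abs_mul, abs_of_pos (by positivity), one_div, inv_mul_le_one₀ pi_pos]
  exact h

lemma abs_cosMoment_le_one {g : ℝ → ℝ} (hg : ∀ θ, |g θ| ≤ 1) (x : ℝ) : |cosMoment g x| ≤ 1 :=
  abs_normalized_integral_le_one fun θ => by
    rw [abs_mul]; exact mul_le_one₀ (hg θ) (abs_nonneg _) (abs_cos_le_one _)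

lemma abs_sinMoment_le_one {g : ℝ → ℝ} (hg : ∀ θ, |g θ| ≤ 1) (x : ℝ) : |sinMoment g x| ≤ 1 :=
  abs_normalized_integral_le_one fun θ => by
    rw [abs_mul]; exact mul_le_one₀ (hg θ) (abs_nonneg _) (abs_sin_le_one _)

/-- The entire function `J₁(x) / x`, in Poisson's integral form. -/
noncomputable def besselQuot (x : ℝ) : ℝ := cosMoment (fun θ => cos θ ^ 2) x

/-- The first derivative of `besselQuot`. -/
noncomputable def besselQuotDeriv (x : ℝ) : ℝ := -sinMoment (fun θ => cos θ ^ 2 * sin θ) x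

/-- The second derivative of `besselQuot`. -/
noncomputable def besselQuotDeriv₂ (x : ℝ) : ℝ :=
  -cosMoment (fun θ => cos θ ^ 2 * sin θ * sin θ) x

lemma hasDerivAt_besselQuot (x : ℝ) : HasDerivAt besselQuot (besselQuotDeriv x) x :=
  hasDerivAt_cosMoment (by fun_prop) x

lemma hasDerivAt_besselQuotDeriv (x : ℝ) :
    HasDerivAt besselQuotDeriv (besselQuotDeriv₂ x) x :=
  (hasDerivAt_sinMoment (by fun_prop) x).neg

lemma continuous_besselQuot : Continuous besselQuot :=
  continuous_iff_continuousAt.2 fun x => (hasDerivAt_besselQuot x).continuousAt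

lemma continuous_besselQuotDeriv : Continuous besselQuotDeriv :=
  continuous_iff_continuousAt.2 fun x => (hasDerivAt_besselQuotDeriv x).continuousAt

lemma continuous_besselQuotDeriv₂ : Continuous besselQuotDeriv₂ :=
  continuous_iff_continuousAt.2 fun x =>
    (hasDerivAt_cosMoment (g := fun θ => cos θ ^ 2 * sin θ * sin θ)
      (by fun_prop) x).neg.continuousAt

lemma abs_cos_sq_le_one (θ : ℝ) : |cos θ ^ 2| ≤ 1 := by
  rw [abs_pow]; exact pow_le_one₀ (abs_nonneg _) (abs_cos_le_one _)

lemma abs_besselQuot_le_one (x : ℝ) : |besselQuot x| ≤ 1 :=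
  abs_cosMoment_le_one abs_cos_sq_le_one x

lemma abs_besselQuotDeriv_le_one (x : ℝ) : |besselQuotDeriv x| ≤ 1 := by
  rw [besselQuotDeriv, abs_neg]
  refine abs_sinMoment_le_one (fun θ => ?_) x
  rw [abs_mul]
  exact mul_le_one₀ (abs_cos_sq_le_one θ) (abs_nonneg _) (abs_sin_le_one _)

lemma abs_besselQuotDeriv₂_le_one (x : ℝ) : |besselQuotDeriv₂ x| ≤ 1 := by
  rw [besselQuotDeriv₂, abs_neg]
  refine abs_cosMoment_le_one (fun θ => ?_) x
  rw [abs_mul, abs_mul]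
  exact mul_le_one₀ (mul_le_one₀ (abs_cos_sq_le_one θ) (abs_nonneg _) (abs_sin_le_one _))
    (abs_nonneg _) (abs_sin_le_one _)

lemma besselQuotDeriv_zero : besselQuotDeriv 0 = 0 := by
  simp [besselQuotDeriv, sinMoment]

lemma besselQuot_zero : besselQuot 0 = 1 / 2 := by
  simp only [besselQuot, cosMoment, zero_mul, cos_zero, mul_one, integral_cos_sq]
  simp
  field_simp

/-- Bessel's equation for `J₁(x) = x * besselQuot x`. -/
lemma besselQuot_ode (x : ℝ) :
    x * besselQuotDeriv₂ x + 3 * besselQuotDeriv x + x * besselQuot x = 0 := by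
  have h := intervalIntegral.integral_eq_sub_of_hasDerivAt (a := 0) (b := π)
    (f := fun θ => cos θ ^ 3 * sin (x * sin θ))
    (f' := fun θ => x * (cos θ ^ 2 * cos (x * sin θ))
      - 3 * (cos θ ^ 2 * sin θ * sin (x * sin θ))
      - x * (cos θ ^ 2 * sin θ * sin θ * cos (x * sin θ)))
    (fun θ _ => by
      have := ((hasDerivAt_cos θ).pow 3).mul (((hasDerivAt_sin θ).const_mul x).sin)
      refine this.congr_deriv ?_
      simp only [Nat.add_one_sub_one, Nat.cast_ofNat, Pi.pow_apply]
      linear_combination (-(x * cos θ ^ 2 * cos (x * sin θ))) * (sin_sq_add_cos_sq θ).symm)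
    ((by fun_prop : Continuous _).intervalIntegrable _ _)
  rw [intervalIntegral.integral_sub, intervalIntegral.integral_sub,
    intervalIntegral.integral_const_mul, intervalIntegral.integral_const_mul,
    intervalIntegral.integral_const_mul] at h
  · simp only [sin_pi, sin_zero, mul_zero, sub_zero] at h
    simp only [besselQuotDeriv₂, besselQuotDeriv, besselQuot, cosMoment, sinMoment]
    linear_combination (1 / π) * h
  all_goals exact (by fun_prop : Continuous _).intervalIntegrable _ _

lemma besselJ_one (x : ℝ) : besselJ 1 x = x * besselQuot x := by
  by_cases hx : x = 0
  · simp [hx, besselJ]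
  have h1 := intervalIntegral.integral_eq_sub_of_hasDerivAt (a := 0) (b := π)
    (f := fun θ => sin (x * sin θ))
    (f' := fun θ => x * (cos θ * cos (x * sin θ)))
    (fun θ _ => (((hasDerivAt_sin θ).const_mul x).sin).congr_deriv (by ring))
    ((by fun_prop : Continuous _).intervalIntegrable _ _)
  have h2 := intervalIntegral.integral_eq_sub_of_hasDerivAt (a := 0) (b := π)
    (f := fun θ => cos θ * sin (x * sin θ))
    (f' := fun θ => x * (cos θ ^ 2 * cos (x * sin θ)) - sin θ * sin (x * sin θ))
    (fun θ _ => ((hasDerivAt_cos θ).mul ((hasDerivAt_sin θ).const_mul x).sin).congr_deriv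
      (by ring))
    ((by fun_prop : Continuous _).intervalIntegrable _ _)
  rw [intervalIntegral.integral_const_mul] at h1
  rw [intervalIntegral.integral_sub ((by fun_prop : Continuous _).intervalIntegrable _ _)
    ((by fun_prop : Continuous _).intervalIntegrable _ _),
    intervalIntegral.integral_const_mul] at h2
  simp only [sin_pi, sin_zero, mul_zero, sub_zero, mul_eq_zero, hx, false_or] at h1 h2
  have h3 : ∀ θ : ℝ, cos (((1 : ℤ) : ℝ) * θ - x * sin θ)
      = cos θ * cos (x * sin θ) + sin θ * sin (x * sin θ) := fun θ => by
    rw [Int.cast_one, one_mul, cos_sub]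
  simp only [besselJ, h3, besselQuot, cosMoment]
  rw [intervalIntegral.integral_add ((by fun_prop : Continuous _).intervalIntegrable _ _)
    ((by fun_prop : Continuous _).intervalIntegrable _ _), h1]
  linear_combination (-(1 / π)) * h2

@[fun_prop]
lemma measurable_besselQuot : Measurable besselQuot := continuous_besselQuot.measurable

@[fun_prop]
lemma measurable_besselQuotDeriv : Measurable besselQuotDeriv :=
  continuous_besselQuotDeriv.measurable

@[fun_prop]
lemma measurable_besselQuotDeriv₂ : Measurable besselQuotDeriv₂ :=
  continuous_besselQuotDeriv₂.measurable

lemma integrableOn_pow_mul_exp_neg_mul (k : ℕ) {c : ℝ} (hc : 0 < c) :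
    IntegrableOn (fun s => s ^ k * exp (-c * s)) (Set.Ioi 0) := by
  have h := integrableOn_rpow_mul_exp_neg_mul_rpow (p := 1) (s := k) (b := c)
    (by have : (0:ℝ) ≤ k := k.cast_nonneg
        linarith) one_pos hc
  simpa using h

/-- Uniqueness for the equation satisfied by `J₁(x) / x` near its regular singular point. -/
lemma eq_zero_of_besselQuot_ode {D D' D'' : ℝ → ℝ} {b : ℝ}
    (h1 : ∀ x ∈ Set.Ico 0 b, HasDerivAt D (D' x) x)
    (h2 : ∀ x ∈ Set.Ico 0 b, HasDerivAt D' (D'' x) x)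
    (ode : ∀ x ∈ Set.Ioo 0 b, x * D'' x + 3 * D' x + x * D x = 0)
    (h0 : D 0 = 0) (h0' : D' 0 = 0) {x : ℝ} (hx : x ∈ Set.Ico 0 b) : D x = 0 := by
  have hder : ∀ y ∈ Set.Ico 0 b,
      HasDerivAt (fun y => D' y ^ 2 + D y ^ 2) (2 * D' y * (D'' y + D y)) y := fun y hy =>
    (((h2 y hy).fun_pow 2).add ((h1 y hy).fun_pow 2)).congr_deriv (by simp; ring)
  have hanti : AntitoneOn (fun y => D' y ^ 2 + D y ^ 2) (Set.Ico 0 b) := by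
    refine antitoneOn_of_deriv_nonpos (convex_Ico 0 b)
      (fun y hy => (hder y hy).continuousAt.continuousWithinAt) ?_ ?_
    all_goals rw [interior_Ico]
    · exact fun y hy =>
        (hder y (Set.Ioo_subset_Ico_self hy)).differentiableAt.differentiableWithinAt
    · intro y hy
      rw [(hder y (Set.Ioo_subset_Ico_self hy)).deriv]
      have : y * (2 * D' y * (D'' y + D y)) = -6 * D' y ^ 2 := by
        linear_combination (2 * D' y) * ode y hy
      have h3 : y * (2 * D' y * (D'' y + D y)) ≤ 0 := by rw [this]; nlinarith [sq_nonneg (D' y)]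
      exact nonpos_of_mul_nonpos_right h3 hy.1
  have := hanti ⟨le_rfl, hx.1.trans_lt hx.2⟩ hx hx.1
  simp only [h0, h0'] at this
  nlinarith [sq_nonneg (D' x), sq_nonneg (D x)]

/-- The weight in the integral representation of `J₁(x) K₁(b)`. -/
noncomputable def macdonaldWeight (b x s : ℝ) : ℝ :=
  exp (-(1 / (2 * s)) - (b ^ 2 - x ^ 2) / 2 * s)

lemma macdonaldWeight_nonneg (b x s : ℝ) : 0 ≤ macdonaldWeight b x s := (exp_pos _).le

lemma macdonaldWeight_le {b x r s : ℝ} (hx : |x| ≤ r) (hs : 0 ≤ s) :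
    macdonaldWeight b x s ≤ exp (-((b ^ 2 - r ^ 2) / 2) * s) := by
  refine exp_le_exp.2 ?_
  have h1 : 0 ≤ 1 / (2 * s) := by positivity
  have h2 : x ^ 2 ≤ r ^ 2 := sq_le_sq' (abs_le.1 hx).1 (abs_le.1 hx).2
  nlinarith

@[fun_prop]
lemma measurable_macdonaldWeight (b x : ℝ) : Measurable (macdonaldWeight b x) := by
  unfold macdonaldWeight; fun_prop

lemma hasDerivAt_macdonaldWeight (b x s : ℝ) :
    HasDerivAt (fun x => macdonaldWeight b x s) (macdonaldWeight b x s * (x * s)) x := by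
  have h := ((((hasDerivAt_pow 2 x).const_sub (b ^ 2)).div_const 2).mul_const s).const_sub
    (-(1 / (2 * s)))
  refine h.exp.congr_deriv ?_
  simp only [macdonaldWeight]
  push_cast
  ring

lemma hasDerivAt_macdonaldWeight_right (b x : ℝ) {s : ℝ} (hs : s ≠ 0) :
    HasDerivAt (macdonaldWeight b x)
      (macdonaldWeight b x s * (1 / (2 * s ^ 2) - (b ^ 2 - x ^ 2) / 2)) s := by
  have h1 : HasDerivAt (fun s : ℝ => 1 / (2 * s)) (-(1 / (2 * s ^ 2))) s := by
    have := ((hasDerivAt_id s).const_mul 2).fun_inv (by simpa using hs)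
    simp only [id, one_div]  at this ⊢
    refine this.congr_deriv ?_
    field_simp
  have h := h1.neg.sub ((hasDerivAt_id s).const_mul ((b ^ 2 - x ^ 2) / 2))
  refine h.exp.congr_deriv ?_
  simp [macdonaldWeight]

/-- The integrand in the integral representation of `J₁(x) K₁(b) / x`. -/
noncomputable def productKernel (b x s : ℝ) : ℝ :=
  macdonaldWeight b x s * besselQuot (x * b * s)

/-- The first `x`-derivative of `productKernel`. -/
noncomputable def productKernelDeriv (b x s : ℝ) : ℝ :=
  macdonaldWeight b x s * (x * s * besselQuot (x * b * s) + b * s * besselQuotDeriv (x * b * s))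

/-- The second `x`-derivative of `productKernel`. -/
noncomputable def productKernelDeriv₂ (b x s : ℝ) : ℝ :=
  macdonaldWeight b x s * ((x ^ 2 * s ^ 2 + s) * besselQuot (x * b * s)
    + 2 * x * b * s ^ 2 * besselQuotDeriv (x * b * s)
    + b ^ 2 * s ^ 2 * besselQuotDeriv₂ (x * b * s))

lemma hasDerivAt_productKernel (b x s : ℝ) :
    HasDerivAt (fun x => productKernel b x s) (productKernelDeriv b x s) x := by
  have hl : HasDerivAt (fun x => x * b * s) (b * s) x :=
    (((hasDerivAt_id x).mul_const b).mul_const s).congr_deriv (by ring)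
  have h := (hasDerivAt_macdonaldWeight b x s).mul
    ((hasDerivAt_besselQuot (x * b * s)).comp x hl)
  refine h.congr_deriv ?_
  simp only [productKernelDeriv, Function.comp_apply]
  ring

lemma hasDerivAt_productKernelDeriv (b x s : ℝ) :
    HasDerivAt (fun x => productKernelDeriv b x s) (productKernelDeriv₂ b x s) x := by
  have hl : HasDerivAt (fun x => x * b * s) (b * s) x :=
    (((hasDerivAt_id x).mul_const b).mul_const s).congr_deriv (by ring)
  have h := (hasDerivAt_macdonaldWeight b x s).mul
    ((((hasDerivAt_id x).mul_const s).mul ((hasDerivAt_besselQuot (x * b * s)).comp x hl)).add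
      (((hasDerivAt_besselQuotDeriv (x * b * s)).comp x hl).const_mul (b * s)))
  refine h.congr_deriv ?_
  simp only [productKernelDeriv₂, Function.comp_apply, Pi.mul_apply, Pi.add_apply, id]
  ring

section Bounds

variable {b x r s : ℝ}

lemma abs_productKernel_le (hx : |x| ≤ r) (hs : 0 ≤ s) :
    |productKernel b x s| ≤ exp (-((b ^ 2 - r ^ 2) / 2) * s) := by
  rw [productKernel, abs_mul, abs_of_nonneg (macdonaldWeight_nonneg _ _ _)]
  exact (mul_le_of_le_one_right (macdonaldWeight_nonneg _ _ _) (abs_besselQuot_le_one _)).trans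
    (macdonaldWeight_le hx hs)

lemma abs_productKernelDeriv_le (hb : 0 ≤ b) (hx : |x| ≤ r) (hr : r ≤ b) (hs : 0 ≤ s) :
    |productKernelDeriv b x s| ≤ 2 * b * (s ^ 1 * exp (-((b ^ 2 - r ^ 2) / 2) * s)) := by
  rw [productKernelDeriv, abs_mul, abs_of_nonneg (macdonaldWeight_nonneg _ _ _)]
  have h0 : |x * s| ≤ b * s := by
    rw [abs_mul, abs_of_nonneg hs]; exact mul_le_mul_of_nonneg_right (hx.trans hr) hs
  have h : |x * s * besselQuot (x * b * s) + b * s * besselQuotDeriv (x * b * s)|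
      ≤ 2 * b * s := by
    refine (abs_add_le _ _).trans ?_
    rw [abs_mul, abs_mul (b * s), abs_of_nonneg (mul_nonneg hb hs)]
    have h1 := mul_le_of_le_one_right (abs_nonneg (x * s)) (abs_besselQuot_le_one (x * b * s))
    have h2 := mul_le_of_le_one_right (mul_nonneg hb hs) (abs_besselQuotDeriv_le_one (x * b * s))
    linarith
  calc _ ≤ exp (-((b ^ 2 - r ^ 2) / 2) * s) * (2 * b * s) :=
        mul_le_mul (macdonaldWeight_le hx hs) h (abs_nonneg _) (exp_pos _).le
    _ = _ := by ring

lemma abs_productKernelDeriv₂_le (hb : 0 ≤ b) (hx : |x| ≤ r) (hr : r ≤ b) (hs : 0 ≤ s) :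
    |productKernelDeriv₂ b x s| ≤ 4 * b ^ 2 * (s ^ 2 * exp (-((b ^ 2 - r ^ 2) / 2) * s))
      + s ^ 1 * exp (-((b ^ 2 - r ^ 2) / 2) * s) := by
  rw [productKernelDeriv₂, abs_mul, abs_of_nonneg (macdonaldWeight_nonneg _ _ _)]
  have hxb := hx.trans hr
  have h : |(x ^ 2 * s ^ 2 + s) * besselQuot (x * b * s)
      + 2 * x * b * s ^ 2 * besselQuotDeriv (x * b * s)
      + b ^ 2 * s ^ 2 * besselQuotDeriv₂ (x * b * s)| ≤ 4 * b ^ 2 * s ^ 2 + s := by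
    have e1 : |x ^ 2 * s ^ 2 + s| ≤ b ^ 2 * s ^ 2 + s := by
      rw [abs_of_nonneg (by positivity), ← sq_abs x]
      gcongr
    have e2 : |2 * x * b * s ^ 2| ≤ 2 * b * b * s ^ 2 := by
      rw [abs_mul, abs_mul, abs_mul, abs_of_nonneg hb, abs_of_nonneg (sq_nonneg s), abs_two]
      gcongr
    have e3 : |b ^ 2 * s ^ 2| = b ^ 2 * s ^ 2 := abs_of_nonneg (by positivity)
    refine (abs_add_le _ _).trans ((add_le_add_left (abs_add_le _ _) _).trans ?_)
    rw [abs_mul, abs_mul (2 * x * b * s ^ 2), abs_mul (b ^ 2 * s ^ 2)]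
    have h1 := mul_le_of_le_one_right (abs_nonneg (x ^ 2 * s ^ 2 + s))
      (abs_besselQuot_le_one (x * b * s))
    have h2 := mul_le_of_le_one_right (abs_nonneg (2 * x * b * s ^ 2))
      (abs_besselQuotDeriv_le_one (x * b * s))
    have h3 := mul_le_of_le_one_right (abs_nonneg (b ^ 2 * s ^ 2))
      (abs_besselQuotDeriv₂_le_one (x * b * s))
    linarith
  calc _ ≤ exp (-((b ^ 2 - r ^ 2) / 2) * s) * (4 * b ^ 2 * s ^ 2 + s) :=
        mul_le_mul (macdonaldWeight_le hx hs) h (abs_nonneg _) (exp_pos _).le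
    _ = _ := by ring

end Bounds

section Integrals

variable {b x r : ℝ}

lemma half_sq_sub_sq_pos (hr : |r| < b) : 0 < (b ^ 2 - r ^ 2) / 2 := by
  have := sq_lt_sq' (abs_lt.1 hr).1 (abs_lt.1 hr).2
  linarith

@[fun_prop]
lemma measurable_productKernel (b x : ℝ) : Measurable (productKernel b x) := by
  unfold productKernel; fun_prop

@[fun_prop]
lemma measurable_productKernelDeriv (b x : ℝ) : Measurable (productKernelDeriv b x) := by
  unfold productKernelDeriv; fun_prop

@[fun_prop]
lemma measurable_productKernelDeriv₂ (b x : ℝ) : Measurable (productKernelDeriv₂ b x) := by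
  unfold productKernelDeriv₂; fun_prop

lemma integrableOn_productKernel (hx : |x| < b) :
    IntegrableOn (productKernel b x) (Set.Ioi 0) := by
  refine (integrableOn_pow_mul_exp_neg_mul 0 (half_sq_sub_sq_pos (r := |x|) (by simpa))).mono'
    (by fun_prop : Measurable _).aestronglyMeasurable ?_
  filter_upwards [ae_restrict_mem measurableSet_Ioi] with s hs
  rw [pow_zero, one_mul]
  exact abs_productKernel_le le_rfl (le_of_lt hs)

lemma hasDerivAt_integral_productKernel (hx : |x| < b) :
    IntegrableOn (productKernelDeriv b x) (Set.Ioi 0) ∧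
    HasDerivAt (fun x => ∫ s in Set.Ioi 0, productKernel b x s)
      (∫ s in Set.Ioi 0, productKernelDeriv b x s) x := by
  obtain ⟨r, hxr, hrb⟩ := exists_between hx
  have hr : 0 < r := (abs_nonneg x).trans_lt hxr
  refine hasDerivAt_integral_of_dominated_loc_of_deriv_le
    (Ioo_mem_nhds (abs_lt.1 hxr).1 (abs_lt.1 hxr).2)
    (.of_forall fun y => (by fun_prop : Measurable _).aestronglyMeasurable)
    (integrableOn_productKernel hx) (by fun_prop : Measurable _).aestronglyMeasurable
    (bound := fun s => 2 * b * (s ^ 1 * exp (-((b ^ 2 - r ^ 2) / 2) * s))) ?_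
    ((integrableOn_pow_mul_exp_neg_mul 1
      (half_sq_sub_sq_pos (by rwa [abs_of_pos hr]))).const_mul _)
    (.of_forall fun s y _ => hasDerivAt_productKernel b y s)
  filter_upwards [ae_restrict_mem measurableSet_Ioi] with s hs y hy
  exact abs_productKernelDeriv_le (hr.trans hrb).le (abs_lt.2 hy).le hrb.le (le_of_lt hs)

lemma hasDerivAt_integral_productKernelDeriv (hx : |x| < b) :
    IntegrableOn (productKernelDeriv₂ b x) (Set.Ioi 0) ∧
    HasDerivAt (fun x => ∫ s in Set.Ioi 0, productKernelDeriv b x s)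
      (∫ s in Set.Ioi 0, productKernelDeriv₂ b x s) x := by
  obtain ⟨r, hxr, hrb⟩ := exists_between hx
  have hr : 0 < r := (abs_nonneg x).trans_lt hxr
  have hc := half_sq_sub_sq_pos (r := r) (b := b) (by rwa [abs_of_pos hr])
  refine hasDerivAt_integral_of_dominated_loc_of_deriv_le
    (Ioo_mem_nhds (abs_lt.1 hxr).1 (abs_lt.1 hxr).2)
    (.of_forall fun y => (by fun_prop : Measurable _).aestronglyMeasurable)
    (hasDerivAt_integral_productKernel hx).1 (by fun_prop : Measurable _).aestronglyMeasurable
    (bound := fun s => 4 * b ^ 2 * (s ^ 2 * exp (-((b ^ 2 - r ^ 2) / 2) * s))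
      + s ^ 1 * exp (-((b ^ 2 - r ^ 2) / 2) * s)) ?_
    (((integrableOn_pow_mul_exp_neg_mul 2 hc).const_mul _).add
      (integrableOn_pow_mul_exp_neg_mul 1 hc))
    (.of_forall fun s y _ => hasDerivAt_productKernelDeriv b y s)
  filter_upwards [ae_restrict_mem measurableSet_Ioi] with s hs y hy
  exact abs_productKernelDeriv₂_le (hr.trans hrb).le (abs_lt.2 hy).le hrb.le (le_of_lt hs)

lemma integral_productKernel_ode (hx : |x| < b) :
    x * (∫ s in Set.Ioi 0, productKernelDeriv₂ b x s)
      + 3 * (∫ s in Set.Ioi 0, productKernelDeriv b x s)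
      + x * (∫ s in Set.Ioi 0, productKernel b x s) = 0 := by
  have i0 := integrableOn_productKernel hx
  have i1 := (hasDerivAt_integral_productKernel hx).1
  have i2 := (hasDerivAt_integral_productKernelDeriv hx).1
  have hc := half_sq_sub_sq_pos (r := |x|) (b := b) (by simpa)
  have hbound : ∀ s, 0 ≤ s → |x * (2 * s ^ 2 * productKernel b x s)|
      ≤ 2 * |x| * (s ^ 2 * exp (-((b ^ 2 - |x| ^ 2) / 2) * s)) := fun s hs => by
    rw [abs_mul, abs_mul (2 * s ^ 2), abs_of_nonneg (by positivity : 0 ≤ 2 * s ^ 2)]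
    have := abs_productKernel_le (b := b) (le_refl |x|) hs
    calc _ ≤ |x| * (2 * s ^ 2 * exp (-((b ^ 2 - |x| ^ 2) / 2) * s)) := by gcongr
      _ = _ := by ring
  have key := integral_Ioi_of_hasDerivAt_of_tendsto (a := 0) (m := 0)
    (f := fun s => x * (2 * s ^ 2 * productKernel b x s))
    (f' := fun s => x * productKernelDeriv₂ b x s + 3 * productKernelDeriv b x s
      + x * productKernel b x s) ?_ ?_ (((i2.const_mul x).add (i1.const_mul 3)).add (i0.const_mul x))
    ?_
  · have i12 : IntegrableOn
        (fun s => x * productKernelDeriv₂ b x s + 3 * productKernelDeriv b x s) (Set.Ioi 0) :=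
      (i2.const_mul x).add (i1.const_mul 3)
    rw [integral_add i12 (i0.const_mul x),
      integral_add (i2.const_mul x) (i1.const_mul 3)] at key
    simpa only [integral_const_mul, ne_eq, OfNat.ofNat_ne_zero, not_false_eq_true, zero_pow,
      mul_zero, zero_mul, sub_zero] using key
  · rw [ContinuousWithinAt]
    simp only [ne_eq, OfNat.ofNat_ne_zero, not_false_eq_true, zero_pow, mul_zero, zero_mul]
    refine squeeze_zero_norm' (a := fun s => 2 * |x| * (s ^ 2 * exp (-((b ^ 2 - |x| ^ 2) / 2) * s)))
      ?_ ?_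
    · filter_upwards [self_mem_nhdsWithin] with s hs using hbound s hs
    · have : Continuous fun s => 2 * |x| * (s ^ 2 * exp (-((b ^ 2 - |x| ^ 2) / 2) * s)) := by
        fun_prop
      have := (this.tendsto 0).mono_left (nhdsWithin_le_nhds (s := Set.Ici 0))
      simpa using this
  · intro s hs
    have hs0 : s ≠ 0 := ne_of_gt hs
    have hl : HasDerivAt (fun s => x * b * s) (x * b) s :=
      ((hasDerivAt_id s).const_mul (x * b)).congr_deriv (by ring)
    have h := (((hasDerivAt_pow 2 s).const_mul 2).mul
      ((hasDerivAt_macdonaldWeight_right b x hs0).mul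
        ((hasDerivAt_besselQuot (x * b * s)).comp s hl))).const_mul x
    refine h.congr_deriv ?_
    simp only [productKernel, productKernelDeriv, productKernelDeriv₂, Function.comp_apply,
      Pi.mul_apply]
    have ode := besselQuot_ode (x * b * s)
    have hE : 2 * s ^ 2 * (1 / (2 * s ^ 2) - (b ^ 2 - x ^ 2) / 2)
        = 1 - s ^ 2 * (b ^ 2 - x ^ 2) := by field_simp
    push_cast
    linear_combination (-(macdonaldWeight b x s * b * s)) * ode
      + x * macdonaldWeight b x s * besselQuot (x * b * s) * hE
  · generalize (b ^ 2 - |x| ^ 2) / 2 = c at hc hbound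
    have h := ((tendsto_pow_mul_exp_neg_atTop_nhds_zero 2).comp
      (Filter.tendsto_id.const_mul_atTop hc)).const_mul (2 * |x| * (c ^ 2)⁻¹)
    refine squeeze_zero_norm' ?_ (by simpa only [mul_zero] using h)
    filter_upwards [Filter.eventually_ge_atTop 0] with s hs
    refine (hbound s hs).trans_eq ?_
    simp only [Function.comp_apply, id]
    rw [mul_pow, neg_mul]
    field_simp

lemma integral_productKernel (hx0 : 0 ≤ x) (hx : x < b) :
    ∫ s in Set.Ioi 0, productKernel b x s
      = 2 * (∫ s in Set.Ioi 0, productKernel b 0 s) * besselQuot x := by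
  have habs : ∀ y ∈ Set.Ico 0 b, |y| < b := fun y hy => by rw [abs_of_nonneg hy.1]; exact hy.2
  set c := 2 * ∫ s in Set.Ioi 0, productKernel b 0 s with hc
  have h := eq_zero_of_besselQuot_ode (b := b)
    (D := fun x => (∫ s in Set.Ioi 0, productKernel b x s) - c * besselQuot x)
    (D' := fun x => (∫ s in Set.Ioi 0, productKernelDeriv b x s) - c * besselQuotDeriv x)
    (D'' := fun x => (∫ s in Set.Ioi 0, productKernelDeriv₂ b x s) - c * besselQuotDeriv₂ x)
    (fun y hy => (hasDerivAt_integral_productKernel (habs y hy)).2.sub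
      ((hasDerivAt_besselQuot y).const_mul c))
    (fun y hy => (hasDerivAt_integral_productKernelDeriv (habs y hy)).2.sub
      ((hasDerivAt_besselQuotDeriv y).const_mul c))
    (fun y hy => by
      linear_combination integral_productKernel_ode (habs y (Set.Ioo_subset_Ico_self hy))
        - c * besselQuot_ode y)
    (by rw [besselQuot_zero, hc]; ring)
    (by simp [besselQuotDeriv_zero, productKernelDeriv])
    ⟨hx0, hx⟩
  exact sub_eq_zero.1 h

end Integrals

lemma integral_univ_eq_integral_Ioi_add_comp_neg {f : ℝ → ℝ} (hf : Integrable f) :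
    ∫ t, f t = ∫ t in Set.Ioi 0, (f t + f (-t)) := by
  rw [integral_add hf.integrableOn hf.comp_neg.integrableOn, integral_comp_neg_Ioi, neg_zero,
    add_comm, intervalIntegral.integral_Iic_add_Ioi hf.integrableOn hf.integrableOn]

lemma integral_macdonaldWeight_zero {b : ℝ} (hb : 0 < b) :
    ∫ s in Set.Ioi 0, macdonaldWeight b 0 s = 2 / b * besselK 1 b := by
  have hint : IntegrableOn (macdonaldWeight b 0) (Set.Ioi 0) := by
    have h := (integrableOn_productKernel (b := b) (x := 0) (by simpa)).const_mul 2
    refine h.congr (.of_forall fun s => ?_)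
    simp [productKernel, besselQuot_zero]
    ring
  have himg : (fun t => exp t / b) '' Set.univ = Set.Ioi 0 := by
    ext s
    simp only [Set.image_univ, Set.mem_range, Set.mem_Ioi]
    refine ⟨fun ⟨t, ht⟩ => ht ▸ by positivity, fun hs => ⟨log (s * b), ?_⟩⟩
    rw [exp_log (by positivity)]
    field_simp
  have hder : ∀ t ∈ (Set.univ : Set ℝ),
      HasDerivWithinAt (fun t => exp t / b) (exp t / b) Set.univ t :=
    fun t _ => ((hasDerivAt_exp t).div_const b).hasDerivWithinAt
  have hinj : Set.InjOn (fun t => exp t / b) Set.univ := fun t _ u _ h =>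
    exp_injective ((div_left_inj' hb.ne').1 h)
  have hcomp : ∀ t, |exp t / b| • macdonaldWeight b 0 (exp t / b)
      = exp t / b * exp (-b * cosh t) := fun t => by
    rw [abs_of_pos (by positivity), smul_eq_mul, macdonaldWeight, cosh_eq, exp_neg t]
    congr 2
    have := exp_ne_zero t
    field_simp
    ring
  rw [← himg] at hint ⊢
  rw [integral_image_eq_integral_abs_deriv_smul MeasurableSet.univ hder hinj]
  rw [integrableOn_image_iff_integrableOn_abs_deriv_smul MeasurableSet.univ hder hinj] at hint
  simp only [hcomp, integrableOn_univ, setIntegral_univ] at hint ⊢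
  rw [integral_univ_eq_integral_Ioi_add_comp_neg hint, besselK, ← integral_const_mul]
  refine integral_congr_ae (.of_forall fun t => ?_)
  simp only [cosh_neg, one_mul]
  rw [cosh_eq t]
  ring

lemma integral_productKernel_eq_besselK {b x : ℝ} (hx0 : 0 ≤ x) (hx : x < b) :
    ∫ s in Set.Ioi 0, productKernel b x s = 2 / b * besselK 1 b * besselQuot x := by
  rw [integral_productKernel hx0 hx, ← integral_macdonaldWeight_zero (hx0.trans_lt hx),
    ← integral_const_mul]
  congr 2
  refine funext fun s => ?_
  simp [productKernel, besselQuot_zero]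
  ring

/-- The integrand of the Laplace transform of `t ↦ t⁻¹ e^{-p/t} J₁(γ t) / γ`. -/
noncomputable def laplaceKernel (p γ q t : ℝ) : ℝ := exp (-p / t - q * t) * besselQuot (γ * t)

@[fun_prop]
lemma measurable_laplaceKernel (p γ q : ℝ) : Measurable (laplaceKernel p γ q) := by
  unfold laplaceKernel; fun_prop

lemma besselJ_mul_besselK {p γ q : ℝ} (hp : 0 < p) (hγ : 0 < γ) (hq : 0 < q) :
    besselJ 1 (√(2 * p) * √(√(q ^ 2 + γ ^ 2) - q)) * besselK 1 (√(2 * p) * √(√(q ^ 2 + γ ^ 2) + q))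
      = γ / 2 * ∫ t in Set.Ioi 0, laplaceKernel p γ q t := by
  have hR : √(q ^ 2 + γ ^ 2) ^ 2 = q ^ 2 + γ ^ 2 := sq_sqrt (by positivity)
  have hRq : q < √(q ^ 2 + γ ^ 2) := lt_sqrt_of_sq_lt (by nlinarith)
  set R := √(q ^ 2 + γ ^ 2)
  set a := √(2 * p) * √(R - q) with ha
  set b := √(2 * p) * √(R + q) with hb
  have ha2 : a ^ 2 = 2 * p * (R - q) := by
    rw [ha, mul_pow, sq_sqrt (by positivity), sq_sqrt (by linarith)]
  have hb2 : b ^ 2 = 2 * p * (R + q) := by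
    rw [hb, mul_pow, sq_sqrt (by positivity), sq_sqrt (by linarith)]
  have ha0 : 0 ≤ a := by positivity
  have hb0 : 0 ≤ b := by positivity
  have hab : a < b := lt_of_pow_lt_pow_left₀ 2 hb0 (by rw [ha2, hb2]; nlinarith)
  have hab2 : a * b = 2 * p * γ := by
    refine (pow_left_inj₀ (by positivity) (by positivity) two_ne_zero).1 ?_
    rw [mul_pow, ha2, hb2]
    linear_combination (4 * p ^ 2) * hR
  have hbpos : 0 < b := ha0.trans_lt hab
  have hscale : ∀ s, productKernel b a s = laplaceKernel p γ q (2 * p * s) := fun s => by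
    rw [productKernel, macdonaldWeight, laplaceKernel, hab2, ha2, hb2]
    congr 2
    · field_simp
      ring
    · ring
  have h := integral_productKernel_eq_besselK ha0 hab
  simp only [hscale] at h
  rw [integral_comp_mul_left_Ioi _ _ (by positivity : 0 < 2 * p), mul_zero, smul_eq_mul] at h
  rw [besselJ_one]
  have h' : ∫ t in Set.Ioi 0, laplaceKernel p γ q t
      = 2 * p * (2 / b * besselK 1 b * besselQuot a) := by
    rw [← h]; field_simp
  rw [h', show γ / 2 * (2 * p * (2 / b * besselK 1 b * besselQuot a))
    = (2 * p * γ) * (besselK 1 b * besselQuot a) / b by ring, ← hab2]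
  field_simp

lemma abs_laplaceKernel_le {p γ q t : ℝ} (hp : 0 ≤ p) (ht : 0 ≤ t) :
    |laplaceKernel p γ q t| ≤ exp (-q * t) := by
  rw [laplaceKernel, abs_mul, abs_exp]
  refine (mul_le_of_le_one_right (exp_pos _).le (abs_besselQuot_le_one _)).trans
    (exp_le_exp.2 ?_)
  have : 0 ≤ p / t := by positivity
  rw [neg_div]
  linarith

lemma hasDerivAt_integral_laplaceKernel {p γ q : ℝ} (hp : 0 < p) (hq : 0 < q) :
    HasDerivAt (fun q => ∫ t in Set.Ioi 0, laplaceKernel p γ q t)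
      (∫ t in Set.Ioi 0, -(t * laplaceKernel p γ q t)) q := by
  refine (hasDerivAt_integral_of_dominated_loc_of_deriv_le (Ioi_mem_nhds (half_lt_self hq))
    (F := laplaceKernel p γ) (F' := fun q t => -(t * laplaceKernel p γ q t))
    (.of_forall fun y => (by fun_prop : Measurable _).aestronglyMeasurable) ?_
    (by fun_prop : Measurable _).aestronglyMeasurable
    (bound := fun t => t ^ 1 * exp (-(q / 2) * t)) ?_
    (integrableOn_pow_mul_exp_neg_mul 1 (half_pos hq)) ?_).2
  · refine (integrableOn_pow_mul_exp_neg_mul 0 hq).mono'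
      (by fun_prop : Measurable _).aestronglyMeasurable ?_
    filter_upwards [ae_restrict_mem measurableSet_Ioi] with t ht
    rw [pow_zero, one_mul]
    exact abs_laplaceKernel_le hp.le (le_of_lt ht)
  · filter_upwards [ae_restrict_mem measurableSet_Ioi] with t ht y hy
    have ht : 0 < t := ht
    have hy : q / 2 < y := hy
    rw [norm_eq_abs, abs_neg, abs_mul, abs_of_pos ht, pow_one]
    refine mul_le_mul_of_nonneg_left ((abs_laplaceKernel_le hp.le ht.le).trans
      (exp_le_exp.2 ?_)) ht.le
    nlinarith
  · refine .of_forall fun t y _ => ?_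
    have h := (((hasDerivAt_id y).mul_const t).const_sub (-p / t)).exp.mul_const
      (besselQuot (γ * t))
    refine h.congr_deriv ?_
    simp only [laplaceKernel, id]
    ring

lemma deriv_besselJ_mul_besselK {p γ q : ℝ} (hp : 0 < p) (hγ : 0 < γ) (hq : 0 < q) :
    deriv (fun q : ℝ => besselJ 1 (√(2 * p) * √(√(q ^ 2 + γ ^ 2) - q)) *
        besselK 1 (√(2 * p) * √(√(q ^ 2 + γ ^ 2) + q))) q
      = -(γ / 2) * ∫ t in Set.Ioi 0, t * laplaceKernel p γ q t := by
  have h := ((hasDerivAt_integral_laplaceKernel (γ := γ) hp hq).const_mul (γ / 2))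
  rw [integral_neg, mul_neg, ← neg_mul] at h
  refine (h.congr_of_eventuallyEq ?_).deriv
  filter_upwards [Ioi_mem_nhds hq] with y hy using besselJ_mul_besselK hp hγ hy

/-- The weight `e^{-p/t} / (eᵗ - 1)` defining the `p`-extended zeta function. -/
noncomputable def zetaWeight (p t : ℝ) : ℝ := exp (-p / t) / (exp t - 1)

@[fun_prop]
lemma measurable_zetaWeight (p : ℝ) : Measurable (zetaWeight p) := by
  unfold zetaWeight; fun_prop

lemma zetaWeight_nonneg (p : ℝ) {t : ℝ} (ht : 0 ≤ t) : 0 ≤ zetaWeight p t :=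
  div_nonneg (exp_pos _).le (sub_nonneg.2 (one_le_exp ht))

lemma zetaWeight_le {p t : ℝ} (hp : 0 < p) (ht : 0 < t) :
    zetaWeight p t ≤ (1 + t) / p * exp (-t) := by
  have h1 : exp (-p / t) ≤ t / p := by
    rw [neg_div, exp_neg, ← inv_div p t]
    exact inv_anti₀ (by positivity) (by linarith [add_one_le_exp (p / t)])
  have h2 : 0 < exp t - 1 := sub_pos.2 (one_lt_exp_iff.2 ht)
  rw [zetaWeight, div_le_iff₀ h2]
  refine h1.trans ?_
  have h3 : t ≤ (1 + t) * (1 - exp (-t)) := by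
    have h4 : (1 + t) * exp (-t) ≤ 1 := by
      rw [exp_neg, ← div_eq_mul_inv, div_le_one (exp_pos _)]
      linarith [add_one_le_exp t]
    linarith
  have h5 : exp (-t) * exp t = 1 := by rw [← exp_add]; simp
  calc t / p ≤ (1 + t) * (1 - exp (-t)) / p := by gcongr
    _ = (1 + t) / p * exp (-t) * (exp t - 1) := by
      linear_combination (-((1 + t) / p)) * h5

lemma integrableOn_mul_zetaWeight_mul_exp {p γ : ℝ} (hp : 0 < p) (hγ : γ < 1) :
    IntegrableOn (fun t => t * zetaWeight p t * exp (γ * t)) (Set.Ioi 0) := by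
  have hc : 0 < 1 - γ := sub_pos.2 hγ
  refine Integrable.mono' (((integrableOn_pow_mul_exp_neg_mul 1 hc).add
    (integrableOn_pow_mul_exp_neg_mul 2 hc)).const_mul (1 / p))
    (by fun_prop : Measurable _).aestronglyMeasurable ?_
  filter_upwards [ae_restrict_mem measurableSet_Ioi] with t ht
  have ht : 0 < t := ht
  have hw := zetaWeight_nonneg p ht.le
  rw [norm_eq_abs, abs_of_nonneg (by positivity)]
  calc t * zetaWeight p t * exp (γ * t)
      ≤ t * ((1 + t) / p * exp (-t)) * exp (γ * t) := by
        gcongr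
        exact zetaWeight_le hp ht
    _ = 1 / p * (t ^ 1 + t ^ 2) * (exp (-t) * exp (γ * t)) := by ring
    _ = 1 / p * (t ^ 1 + t ^ 2) * exp (-(1 - γ) * t) := by
        rw [← exp_add]; ring_nf
    _ = _ := by simp only [Pi.add_apply]; ring

lemma hasSum_exp_neg_div_sub {p t : ℝ} (ht : 0 < t) :
    HasSum (fun k : ℕ => exp (-p / t - (k + 1) * t)) (zetaWeight p t) := by
  have hr : exp (-t) < 1 := exp_lt_one_iff.2 (by linarith)
  have h := (hasSum_geometric_of_lt_one (exp_pos (-t)).le hr).mul_left (exp (-p / t) * exp (-t))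
  have h1 : exp t - 1 ≠ 0 := (sub_pos.2 (one_lt_exp_iff.2 ht)).ne'
  have hsum : exp (-p / t) * exp (-t) * (1 - exp (-t))⁻¹ = zetaWeight p t := by
    have h2 : 1 - exp (-t) = exp (-t) * (exp t - 1) := by
      rw [mul_sub, ← exp_add]; simp
    have := exp_ne_zero (-t)
    rw [zetaWeight, h2]
    field_simp
  rw [hsum] at h
  refine h.congr_fun fun k => ?_
  rw [← exp_nat_mul, ← exp_add, ← exp_add]
  ring_nf

lemma hasSum_integral_mul_laplaceKernel {p : ℝ} (γ : ℝ) (hp : 0 < p) :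
    HasSum (fun k : ℕ => ∫ t in Set.Ioi 0, t * laplaceKernel p γ (k + 1) t)
      (∫ t in Set.Ioi 0, t * zetaWeight p t * besselQuot (γ * t)) := by
  have hpos : ∀ᵐ t ∂(volume.restrict (Set.Ioi (0:ℝ))), 0 < t :=
    ae_restrict_mem measurableSet_Ioi
  refine hasSum_integral_of_dominated_convergence
    (fun (k : ℕ) t => t * exp (-p / t - (k + 1) * t))
    (fun k => (by fun_prop : Measurable _).aestronglyMeasurable) (fun k => ?_) ?_ ?_ ?_
  · filter_upwards [hpos] with t ht
    rw [norm_eq_abs, abs_mul, abs_of_pos ht, laplaceKernel, abs_mul, abs_exp]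
    exact mul_le_mul_of_nonneg_left
      (mul_le_of_le_one_right (exp_pos _).le (abs_besselQuot_le_one _)) ht.le
  · filter_upwards [hpos] with t ht using ((hasSum_exp_neg_div_sub ht).mul_left t).summable
  · refine (integrableOn_mul_zetaWeight_mul_exp hp zero_lt_one).congr ?_
    filter_upwards [hpos] with t ht
    rw [((hasSum_exp_neg_div_sub ht).mul_left t).tsum_eq, zero_mul, exp_zero, mul_one]
  · filter_upwards [hpos] with t ht
    simpa only [laplaceKernel, mul_assoc] using
      ((hasSum_exp_neg_div_sub (p := p) ht).mul_right (besselQuot (γ * t))).mul_left t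

/-- The moments `(1/π) ∫₀^π cos² θ sin^{2m} θ dθ`. -/
noncomputable def sinPowMoment (m : ℕ) : ℝ :=
  (1 / π) * ∫ θ in (0:ℝ)..π, cos θ ^ 2 * sin θ ^ (2 * m)

lemma abs_sinPowMoment_le_one (m : ℕ) : |sinPowMoment m| ≤ 1 :=
  abs_normalized_integral_le_one fun θ => by
    rw [abs_mul, abs_pow (sin θ)]
    exact mul_le_one₀ (abs_cos_sq_le_one θ) (by positivity)
      (pow_le_one₀ (abs_nonneg _) (abs_sin_le_one _))

lemma hasSum_besselQuot (x : ℝ) :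
    HasSum (fun m : ℕ => (-1) ^ m * sinPowMoment m * (x ^ (2 * m) / (2 * m).factorial))
      (besselQuot x) := by
  have h := intervalIntegral.hasSum_integral_of_dominated_convergence
    (μ := volume) (a := 0) (b := π)
    (F := fun (m : ℕ) θ => cos θ ^ 2 * ((-1) ^ m * (x * sin θ) ^ (2 * m) / (2 * m).factorial))
    (f := fun θ => cos θ ^ 2 * cos (x * sin θ))
    (fun m _ => x ^ (2 * m) / (2 * m).factorial)
    (fun m => (by fun_prop : Continuous _).aestronglyMeasurable)
    (fun m => .of_forall fun θ _ => by
      have h1 : |(x * sin θ) ^ (2 * m)| ≤ x ^ (2 * m) := by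
        rw [mul_pow, abs_mul, abs_of_nonneg ((even_two_mul m).pow_nonneg x), abs_pow]
        exact mul_le_of_le_one_right ((even_two_mul m).pow_nonneg x)
          (pow_le_one₀ (abs_nonneg _) (abs_sin_le_one _))
      rw [norm_eq_abs, abs_mul, abs_div, abs_mul, abs_pow (-1 : ℝ), abs_neg, abs_one, one_pow,
        one_mul, Nat.abs_cast]
      calc _ ≤ 1 * (x ^ (2 * m) / (2 * m).factorial) :=
            mul_le_mul (abs_cos_sq_le_one θ) (by gcongr) (by positivity) zero_le_one
        _ = _ := one_mul _)
    (.of_forall fun θ _ => (hasSum_cosh x).summable)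
    (continuous_const.intervalIntegrable _ _)
    (.of_forall fun θ _ => (hasSum_cos (x * sin θ)).mul_left _)
  refine (h.mul_left (1 / π)).congr_fun fun m => ?_
  rw [sinPowMoment, show (-1 : ℝ) ^ m * ((1 / π) * ∫ θ in (0:ℝ)..π, cos θ ^ 2 * sin θ ^ (2 * m))
    * (x ^ (2 * m) / (2 * m).factorial) = (1 / π) * ((-1) ^ m * (x ^ (2 * m) / (2 * m).factorial)
    * ∫ θ in (0:ℝ)..π, cos θ ^ 2 * sin θ ^ (2 * m)) by ring,
    ← intervalIntegral.integral_const_mul]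
  congr 2
  refine funext fun θ => ?_
  rw [mul_pow]
  ring

lemma hasSum_integral_zetaWeight {p γ : ℝ} (hp : 0 < p) (hγ0 : 0 ≤ γ) (hγ1 : γ < 1) :
    HasSum (fun m : ℕ => ∫ t in Set.Ioi 0, t * zetaWeight p t *
        ((-1) ^ m * sinPowMoment m * ((γ * t) ^ (2 * m) / (2 * m).factorial)))
      (∫ t in Set.Ioi 0, t * zetaWeight p t * besselQuot (γ * t)) := by
  have hpos : ∀ᵐ t ∂(volume.restrict (Set.Ioi (0:ℝ))), 0 < t :=
    ae_restrict_mem measurableSet_Ioi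
  refine hasSum_integral_of_dominated_convergence
    (fun (m : ℕ) t => t * zetaWeight p t * ((γ * t) ^ (2 * m) / (2 * m).factorial))
    (fun m => (by fun_prop : Measurable _).aestronglyMeasurable) (fun m => ?_)
    (.of_forall fun t => ((hasSum_cosh (γ * t)).mul_left _).summable) ?_
    (.of_forall fun t => (hasSum_besselQuot (γ * t)).mul_left _)
  · filter_upwards [hpos] with t ht
    have hw := zetaWeight_nonneg p ht.le
    have hx : 0 ≤ (γ * t) ^ (2 * m) / (2 * m).factorial := by positivity
    rw [norm_eq_abs, abs_mul, abs_of_nonneg (by positivity : 0 ≤ t * zetaWeight p t), abs_mul,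
      abs_of_nonneg hx, abs_mul, abs_pow, abs_neg, abs_one, one_pow, one_mul]
    exact mul_le_mul_of_nonneg_left
      (mul_le_of_le_one_left hx (abs_sinPowMoment_le_one m)) (by positivity)
  · simp only [fun t => ((hasSum_cosh (γ * t)).mul_left (t * zetaWeight p t)).tsum_eq]
    refine (integrableOn_mul_zetaWeight_mul_exp hp hγ1).mono'
      (by fun_prop : Measurable _).aestronglyMeasurable ?_
    filter_upwards [hpos] with t ht
    have hw := zetaWeight_nonneg p ht.le
    rw [norm_eq_abs, abs_of_nonneg (mul_nonneg (by positivity) (cosh_pos _).le)]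
    refine mul_le_mul_of_nonneg_left ?_ (by positivity)
    have : exp (-(γ * t)) ≤ exp (γ * t) := exp_le_exp.2 (by linarith [mul_nonneg hγ0 ht.le])
    rw [cosh_eq]
    linarith

lemma Gamma_nat_add_half_div (n : ℕ) :
    Real.Gamma (n + 1 / 2) / (n.factorial * Real.Gamma (1 / 2))
      = ∏ i ∈ Finset.range n, (2 * (i : ℝ) + 1) / (2 * i + 2) := by
  have hG : Real.Gamma (1 / 2) ≠ 0 := (Gamma_pos_of_pos (by norm_num)).ne'
  induction n with
  | zero => simpa using div_self hG
  | succ n ih =>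
    rw [Finset.prod_range_succ, ← ih, Nat.factorial_succ, Nat.cast_succ,
      show (n : ℝ) + 1 + 1 / 2 = (n + 1 / 2) + 1 by ring, Gamma_add_one (by positivity)]
    have : (n.factorial : ℝ) ≠ 0 := by positivity
    push_cast
    field_simp

lemma Gamma_div_eq_sinPowMoment (m : ℕ) :
    Real.Gamma ((m + 1 : ℕ) + 1 / 2) / ((m + 1).factorial * Real.Gamma (1 / 2))
      = (2 * m + 1) * sinPowMoment m := by
  have h : sinPowMoment m = (1 / π) * ((∫ θ in (0:ℝ)..π, sin θ ^ (2 * m))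
      - ∫ θ in (0:ℝ)..π, sin θ ^ (2 * (m + 1))) := by
    rw [sinPowMoment, ← intervalIntegral.integral_sub
      ((by fun_prop : Continuous _).intervalIntegrable _ _)
      ((by fun_prop : Continuous _).intervalIntegrable _ _)]
    congr 2
    refine funext fun θ => ?_
    rw [cos_sq']
    ring
  rw [Gamma_nat_add_half_div, h, integral_sin_pow_even, integral_sin_pow_even,
    Finset.prod_range_succ]
  field_simp
  ring

lemma zetaP_even (p : ℝ) (m : ℕ) :
    zetaP p (2 * m + 2) = 1 / (2 * m + 1).factorial *
      ∫ t in Set.Ioi 0, t ^ (2 * m + 1) * zetaWeight p t := by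
  rw [zetaP, show (2 * m + 2 : ℝ) = ((2 * m + 1 : ℕ) : ℝ) + 1 by push_cast; ring,
    Gamma_nat_eq_factorial]
  congr 2
  refine funext fun t => ?_
  rw [add_sub_cancel_right, rpow_natCast, zetaWeight, mul_div_assoc]

lemma mathieuS_eq_integral {p γ : ℝ} (hp : 0 < p) (hγ0 : 0 ≤ γ) (hγ1 : γ < 1) :
    mathieuS (-(1/2)) p γ
      = -2 * γ ^ 2 * ∫ t in Set.Ioi 0, t * zetaWeight p t * besselQuot (γ * t) := by
  have h := (hasSum_integral_zetaWeight hp hγ0 hγ1).mul_left (-γ ^ 2)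
  set f : ℕ → ℝ := fun n => (-1 : ℝ) ^ n *
      (Real.Gamma (-(1/2) + n + 1) / (n.factorial * Real.Gamma (-(1/2) + 1))) *
      zetaP p (2 * -(1/2) + 2 * n + 1) * γ ^ (2 * n) with hf
  have h0 : f 0 = 0 := by simp [hf, zetaP]
  have hsucc : ∀ m : ℕ, f (m + 1) = -γ ^ 2 * ∫ t in Set.Ioi 0, t * zetaWeight p t *
        ((-1) ^ m * sinPowMoment m * ((γ * t) ^ (2 * m) / (2 * m).factorial)) := fun m => by
    have e : ∀ t, t * zetaWeight p t *
        ((-1) ^ m * sinPowMoment m * ((γ * t) ^ (2 * m) / (2 * m).factorial))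
        = (-1) ^ m * sinPowMoment m * (γ ^ (2 * m) / (2 * m).factorial)
          * (t ^ (2 * m + 1) * zetaWeight p t) := fun t => by rw [mul_pow]; ring
    simp only [hf, e, integral_const_mul]
    rw [show -(1 / 2 : ℝ) + (m + 1 : ℕ) + 1 = (m + 1 : ℕ) + 1 / 2 by ring,
      show -(1 / 2 : ℝ) + 1 = 1 / 2 by norm_num, Gamma_div_eq_sinPowMoment,
      show 2 * -(1 / 2 : ℝ) + 2 * (m + 1 : ℕ) + 1 = 2 * m + 2 by push_cast; ring, zetaP_even,
      Nat.factorial_succ]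
    have : ((2 * m).factorial : ℝ) ≠ 0 := by positivity
    push_cast
    field_simp
    ring
  have hs := (hasSum_nat_add_iff 1).1 (h.congr_fun hsucc)
  rw [Finset.sum_range_one, h0, add_zero] at hs
  rw [mathieuS, hs.tsum_eq]
  ring

theorem stmt2 (p γ : ℝ) (hp : 0 < p) (hγ0 : 0 < γ) (hγ1 : γ < 1) :
    mathieuS (-(1/2)) p γ =
      4 * γ *
        ∑' k : ℕ, deriv
          (fun q : ℝ =>
            besselJ 1 (Real.sqrt (2 * p) * Real.sqrt (Real.sqrt (q ^ 2 + γ ^ 2) - q)) *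
              besselK 1 (Real.sqrt (2 * p) * Real.sqrt (Real.sqrt (q ^ 2 + γ ^ 2) + q)))
          (k + 1) := by
  have hderiv : ∀ k : ℕ, deriv
      (fun q : ℝ =>
        besselJ 1 (Real.sqrt (2 * p) * Real.sqrt (Real.sqrt (q ^ 2 + γ ^ 2) - q)) *
          besselK 1 (Real.sqrt (2 * p) * Real.sqrt (Real.sqrt (q ^ 2 + γ ^ 2) + q)))
      (k + 1) = -(γ / 2) * ∫ t in Set.Ioi 0, t * laplaceKernel p γ (k + 1) t :=
    fun k => deriv_besselJ_mul_besselK hp hγ0 (by positivity)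
  simp only [hderiv]
  rw [((hasSum_integral_mul_laplaceKernel γ hp).mul_left (-(γ / 2))).tsum_eq,
    mathieuS_eq_integral hp hγ0.le hγ1]
  ring
end
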